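/- Let a ≥ 1 and k ≥ 5 be integers with k odd, and set b = ak+2. Let T be any tree with exactly k interior (non-leaf) vertices and b leaves. Then λ₁(T) ≤ λ₁(SLP(a+1, a; 2; (k−3)/2, (k−3)/2)), and equality holds if and only if T is isomorphic to the star-like path tree SLP(a+1, a; 2; (k−3)/2, (k−3)/2). -/

import Mathlib

open scoped Classical
open Finset

/-- The Dirichlet energy `∑_{{x,y} ∈ E} (f(x) - f(y))²` of a function on the vertices,
computed as half of the sum over ordered adjacent pairs. -/
noncomputable def dirichletForm {V : Type*} [Fintype V] (G : SimpleGraph V) (f : V → ℝ) : ℝ :=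
  (∑ x : V, ∑ y : V, if G.Adj x y then (f x - f y) ^ 2 else 0) / 2

/-- The first Dirichlet eigenvalue of a graph `G` with boundary `B`:
the infimum of Rayleigh quotients of nonzero functions vanishing on `B`. -/
noncomputable def lambda1 {V : Type*} [Fintype V] (G : SimpleGraph V) (B : Finset V) : ℝ :=
  sInf { r : ℝ | ∃ f : V → ℝ, (∀ x ∈ B, f x = 0) ∧ f ≠ 0 ∧
    r = dirichletForm G f / ∑ x ∈ Bᶜ, f x ^ 2 }

/-- The distance from a vertex to a set of vertices. -/
noncomputable def distToSet {V : Type*} (G : SimpleGraph V) (B : Finset V) (v : V) : ℕ :=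
  sInf { n : ℕ | ∃ b ∈ B, G.dist v b = n }

/-- The inscribed radius of a graph with boundary: `max_{v ∈ V} dist(v, B)`. -/
noncomputable def inradius {V : Type*} [Fintype V] (G : SimpleGraph V) (B : Finset V) : ℕ :=
  Finset.univ.sup fun v => distToSet G B v

/-- The diameter of a graph: `max_{v,w ∈ V} dist(v, w)`. -/
noncomputable def graphDiam {V : Type*} [Fintype V] (G : SimpleGraph V) : ℕ :=
  Finset.univ.sup fun v => Finset.univ.sup fun w => G.dist v w

/-- The set of leaves (degree-one vertices) of a graph. -/
noncomputable def leaves {V : Type*} [Fintype V] (G : SimpleGraph V) : Finset V :=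
  Finset.univ.filter fun v => G.degree v = 1

/-- Vertex type of the star-like path tree `SLP(p, q; c; d, e)`:
`path i` are the path vertices `u₀, …, u_c`; `dbr i` are the vertices `u_{0,i}` attached
to `u₀`; `ebr j` are the vertices `u_{c,j}` attached to `u_c`; `pleaf0` are the `p`
pendant leaves at `u₀`; `pleafc` are the `p` pendant leaves at `u_c` (absent when
`c = 0`, since then `u_c = u₀`); `qleafD i m`, `qleafE j m`, `qleafM m m'` are the `q`
pendant leaves at `u_{0,i}`, at `u_{c,j}`, and at the interior path vertex `u_{m+1}`
(`1 ≤ m+1 ≤ c-1`), respectively. -/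
inductive SLPVert (p q c d e : ℕ) : Type where
  | path : Fin (c + 1) → SLPVert p q c d e
  | dbr : Fin d → SLPVert p q c d e
  | ebr : Fin e → SLPVert p q c d e
  | pleaf0 : Fin p → SLPVert p q c d e
  | pleafc : Fin (if c = 0 then 0 else p) → SLPVert p q c d e
  | qleafD : Fin d → Fin q → SLPVert p q c d e
  | qleafE : Fin e → Fin q → SLPVert p q c d e
  | qleafM : Fin (c - 1) → Fin q → SLPVert p q c d e
deriving DecidableEq, Fintype

/-- Base relation generating the edges of the star-like path tree. -/
def SLPRel {p q c d e : ℕ} : SLPVert p q c d e → SLPVert p q c d e → Prop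
  | .path i, .path j => (i : ℕ) + 1 = (j : ℕ)
  | .path i, .dbr _ => (i : ℕ) = 0
  | .path i, .ebr _ => (i : ℕ) = c
  | .path i, .pleaf0 _ => (i : ℕ) = 0
  | .path i, .pleafc _ => (i : ℕ) = c
  | .path i, .qleafM m _ => (i : ℕ) = (m : ℕ) + 1
  | .dbr i, .qleafD i' _ => i = i'
  | .ebr j, .qleafE j' _ => j = j'
  | _, _ => False

/-- The star-like path tree `SLP(p, q; c; d, e)`. -/
def SLP (p q c d e : ℕ) : SimpleGraph (SLPVert p q c d e) :=
  SimpleGraph.fromRel SLPRel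

/-- A nonempty set of vertices closed under adjacency contains every vertex of a connected graph. -/
lemma SimpleGraph.Connected.mem_of_adj_closed {W : Type*} {H : SimpleGraph W} (hH : H.Connected)
    {X : Set W} (hX : ∀ u v, H.Adj u v → u ∈ X → v ∈ X) {x : W} (hx : x ∈ X) (y : W) : y ∈ X := by
  obtain ⟨p⟩ := hH.preconnected x y
  induction p with
  | nil => exact hx
  | cons h _ ih => exact ih (hX _ _ h hx)

/-- `S` contains `x` but not `y`, and the only edge leaving `S` is the one from `x` to `y`. -/
structure IsSide {W : Type*} [Fintype W] (H : SimpleGraph W) (x y : W) (S : Finset W) : Prop where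
  left : x ∈ S
  right : y ∉ S
  cut : ∀ u ∈ S, ∀ v ∉ S, H.Adj u v → u = x ∧ v = y

section Sides

variable {W : Type*} [Fintype W] {H : SimpleGraph W}

lemma exists_isSide (hH : H.IsAcyclic) {x y : W} (h : H.Adj x y) : ∃ S, IsSide H x y S := by
  have hb := SimpleGraph.isBridge_iff.1 (SimpleGraph.isAcyclic_iff_forall_adj_isBridge.1 hH h)
  refine ⟨univ.filter fun z => (H.deleteEdges {s(x, y)}).Reachable x z, ?_, ?_, ?_⟩
  · simp
  · simpa using hb
  · intro u hu v hv huv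
    simp only [mem_filter, mem_univ, true_and] at hu hv
    by_cases he : s(u, v) = s(x, y)
    · rcases Sym2.eq_iff.1 he with h1 | ⟨rfl, rfl⟩
      · exact h1
      · exact absurd hu hb
    · exact absurd (hu.trans (SimpleGraph.Adj.reachable (by simp [huv, he]))) hv

lemma IsSide.compl {x y : W} {S : Finset W} (h : IsSide H x y S) : IsSide H y x Sᶜ where
  left := by simpa using h.right
  right := by simpa using h.left
  cut u hu v hv huv := by
    simp only [mem_compl, not_not] at hu hv
    exact (h.cut v hv u hu huv.symm).symm

/-- The endpoints of an edge lie on the same side of any other edge. -/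
lemma IsSide.mem_of_adj {x y u v : W} {S : Finset W} (h : IsSide H x y S) (huv : H.Adj u v)
    (hne : s(u, v) ≠ s(x, y)) (hu : u ∈ S) : v ∈ S := by
  by_contra hv
  obtain ⟨rfl, rfl⟩ := h.cut u hu v hv huv
  exact hne rfl

lemma IsSide.mem_iff_of_adj {x y u v : W} {S : Finset W} (h : IsSide H x y S) (huv : H.Adj u v)
    (hne : s(u, v) ≠ s(x, y)) : u ∈ S ↔ v ∈ S :=
  ⟨h.mem_of_adj huv hne, h.mem_of_adj huv.symm (by rwa [Sym2.eq_swap])⟩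

/-- The far sides of two edges which lie on the near side of one another are disjoint. -/
lemma IsSide.disjoint_compl (hH : H.Connected) {x₁ y₁ x₂ y₂ : W} {S₁ S₂ : Finset W}
    (h₁ : IsSide H x₁ y₁ S₁) (h₂ : IsSide H x₂ y₂ S₂) (hy₁ : y₁ ∈ S₂) (hy₂ : y₂ ∈ S₁) :
    Disjoint S₁ᶜ S₂ᶜ := by
  rw [Finset.disjoint_left]
  intro z hz₁ hz₂
  have := hH.mem_of_adj_closed (X := {z | z ∈ S₁ᶜ ∧ z ∈ S₂ᶜ}) (x := z) ?_ ⟨hz₁, hz₂⟩ x₁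
  · exact absurd h₁.left (by simpa using this.1)
  · rintro u v huv ⟨hu₁, hu₂⟩
    constructor
    · by_contra hv
      obtain ⟨rfl, rfl⟩ := h₁.compl.cut u hu₁ v hv huv
      exact absurd hy₁ (by simpa using hu₂)
    · by_contra hv
      obtain ⟨rfl, rfl⟩ := h₂.compl.cut u hu₂ v hv huv
      exact absurd hy₂ (by simpa using hu₁)

end Sides

/-- The relative differences `w x y = 1 - f y / f x` of a positive eigenfunction `f`, with
eigenvalue `lam`, of the Laplacian of `H` plus the integral potential `g`. -/
structure IsEigenRatio {W : Type*} [Fintype W] (H : SimpleGraph W) (g : W → ℤ) (lam : ℝ)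
    (w : W → W → ℝ) : Prop where
  lt_one : ∀ x y, H.Adj x y → w x y < 1
  mul_eq : ∀ x y, H.Adj x y → (1 - w x y) * (1 - w y x) = 1
  sum_eq : ∀ x, ∑ y, (if H.Adj x y then w x y else 0) = lam - g x

/-- An edge both of whose relative differences are less than `lam`. -/
structure IsFlat {W : Type*} (H : SimpleGraph W) (lam : ℝ) (w : W → W → ℝ) (x y : W) : Prop where
  adj : H.Adj x y
  lt : w x y < lam
  lt' : w y x < lam

lemma IsFlat.symm {W : Type*} {H : SimpleGraph W} {lam : ℝ} {w : W → W → ℝ} {x y : W}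
    (h : IsFlat H lam w x y) : IsFlat H lam w y x := ⟨h.adj.symm, h.lt', h.lt⟩

namespace IsEigenRatio

variable {W : Type*} [Fintype W] {H : SimpleGraph W} {g : W → ℤ} {lam : ℝ} {w : W → W → ℝ}

lemma add_nonpos (hw : IsEigenRatio H g lam w) {x y : W} (h : H.Adj x y) :
    w x y + w y x ≤ 0 := by
  have h1 := hw.lt_one x y h
  have h2 := hw.lt_one y x h.symm
  have h3 := hw.mul_eq x y h
  nlinarith [sq_nonneg (w x y - w y x), sq_nonneg ((1 - w x y) - (1 - w y x))]

lemma le_sum_cut (hw : IsEigenRatio H g lam w) (S : Finset W) (P : Finset (W × W))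
    (hP : ∀ x y, (x, y) ∈ P ↔ x ∈ S ∧ y ∉ S ∧ H.Adj x y) :
    #S * lam - ((∑ x ∈ S, g x : ℤ) : ℝ) ≤ ∑ p ∈ P, w p.1 p.2 := by
  have hPeq : P = (S ×ˢ Sᶜ).filter fun p => H.Adj p.1 p.2 := by
    ext ⟨x, y⟩
    simp [hP, and_assoc]
  have h1 : ∑ x ∈ S, ∑ y, (if H.Adj x y then w x y else 0) = #S * lam - ((∑ x ∈ S, g x : ℤ) : ℝ) := by
    rw [Finset.sum_congr rfl fun x _ => hw.sum_eq x, Finset.sum_sub_distrib]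
    simp
  have h2 : ∑ x ∈ S, ∑ y, (if H.Adj x y then w x y else 0) =
      ∑ x ∈ S, ∑ y ∈ S, (if H.Adj x y then w x y else 0) + ∑ p ∈ P, w p.1 p.2 := by
    rw [hPeq, Finset.sum_filter, Finset.sum_product, ← Finset.sum_add_distrib]
    exact Finset.sum_congr rfl fun x _ => (Finset.sum_add_sum_compl S _).symm
  have h3 : ∑ x ∈ S, ∑ y ∈ S, (if H.Adj x y then w x y else 0) ≤ 0 := by
    have h4 : ∑ x ∈ S, ∑ y ∈ S, (if H.Adj x y then w x y else 0) =
        ∑ x ∈ S, ∑ y ∈ S, (if H.Adj x y then w y x else 0) := by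
      rw [Finset.sum_comm]
      simp only [H.adj_comm]
    have h5 : ∑ x ∈ S, ∑ y ∈ S, (if H.Adj x y then w x y else 0) +
        ∑ x ∈ S, ∑ y ∈ S, (if H.Adj x y then w y x else 0) ≤ 0 := by
      simp only [← Finset.sum_add_distrib]
      refine Finset.sum_nonpos fun x _ => Finset.sum_nonpos fun y _ => ?_
      split_ifs with h
      · exact hw.add_nonpos h
      · simp
    linarith
  linarith

lemma le_of_isSide (hw : IsEigenRatio H g lam w) {x y : W} {S : Finset W} (hS : IsSide H x y S)
    (h : H.Adj x y) : #S * lam - ((∑ x ∈ S, g x : ℤ) : ℝ) ≤ w x y := by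
  have := hw.le_sum_cut S {(x, y)} fun u v => by
    simp only [mem_singleton, Prod.mk.injEq]
    constructor
    · rintro ⟨rfl, rfl⟩
      exact ⟨hS.left, hS.right, h⟩
    · rintro ⟨hu, hv, huv⟩
      exact hS.cut u hu v hv huv
  simpa using this

lemma lt_of_sum_nonpos (hw : IsEigenRatio H g lam w) (hl : 0 < lam) {x y : W} {S : Finset W}
    (hS : IsSide H x y S) (h : H.Adj x y) (hg : ∑ x ∈ S, g x ≤ 0) : lam ≤ w x y := by
  have h1 := hw.le_of_isSide hS h
  have h2 : (1 : ℝ) ≤ #S := by exact_mod_cast Finset.card_pos.2 ⟨x, hS.left⟩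
  have h3 : ((∑ x ∈ S, g x : ℤ) : ℝ) ≤ 0 := by exact_mod_cast hg
  nlinarith

/-- The potential has total one on each side of a flat edge. -/
lemma sum_eq_one_of_isFlat (hw : IsEigenRatio H g lam w) (hl : 0 < lam) (hg : ∑ x, g x = 2)
    {x y : W} {S : Finset W} (hS : IsSide H x y S) (h : IsFlat H lam w x y) :
    ∑ x ∈ S, g x = 1 ∧ ∑ x ∈ Sᶜ, g x = 1 := by
  have h1 : 0 < ∑ x ∈ S, g x := by
    by_contra hc
    exact absurd (hw.lt_of_sum_nonpos hl hS h.adj (not_lt.1 hc)) (not_le.2 h.lt)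
  have h2 : 0 < ∑ x ∈ Sᶜ, g x := by
    by_contra hc
    exact absurd (hw.lt_of_sum_nonpos hl hS.compl h.adj.symm (not_lt.1 hc)) (not_le.2 h.lt')
  have h3 := Finset.sum_add_sum_compl S g
  omega

lemma sum_inter (hg : ∑ x, g x = 2) {S₁ S₂ : Finset W} (hd : Disjoint S₁ᶜ S₂ᶜ)
    (h₁ : ∑ x ∈ S₁ᶜ, g x = 1) (h₂ : ∑ x ∈ S₂ᶜ, g x = 1) : ∑ x ∈ S₁ ∩ S₂, g x = 0 := by
  have h3 := Finset.sum_add_sum_compl (S₁ ∩ S₂) g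
  rw [Finset.compl_inter, Finset.sum_union hd] at h3
  omega

lemma le_add_of_isSide (hw : IsEigenRatio H g lam w) (hH : H.Connected) (hg : ∑ x, g x = 2)
    {x₁ y₁ x₂ y₂ : W} {S₁ S₂ : Finset W} (h₁ : IsSide H x₁ y₁ S₁) (h₂ : IsSide H x₂ y₂ S₂)
    (ha₁ : H.Adj x₁ y₁) (ha₂ : H.Adj x₂ y₂) (hx₁ : x₁ ∈ S₂) (hy₁ : y₁ ∈ S₂)
    (hx₂ : x₂ ∈ S₁) (hy₂ : y₂ ∈ S₁) (hg₁ : ∑ x ∈ S₁ᶜ, g x = 1) (hg₂ : ∑ x ∈ S₂ᶜ, g x = 1) :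
    #(S₁ ∩ S₂) * lam ≤ w x₁ y₁ + w x₂ y₂ := by
  have hne : (x₁, y₁) ≠ (x₂, y₂) := by
    rintro h
    simp only [Prod.mk.injEq] at h
    exact h₁.right (h.2 ▸ hy₂)
  have := hw.le_sum_cut (S₁ ∩ S₂) {(x₁, y₁), (x₂, y₂)} fun u v => by
    simp only [mem_insert, mem_singleton, Prod.mk.injEq, mem_inter, not_and_or]
    constructor
    · rintro (⟨rfl, rfl⟩ | ⟨rfl, rfl⟩)
      · exact ⟨⟨h₁.left, hx₁⟩, Or.inl h₁.right, ha₁⟩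
      · exact ⟨⟨hx₂, h₂.left⟩, Or.inr h₂.right, ha₂⟩
    · rintro ⟨⟨hu₁, hu₂⟩, hv | hv, huv⟩
      · exact Or.inl (h₁.cut u hu₁ v hv huv)
      · exact Or.inr (h₂.cut u hu₂ v hv huv)
  rw [sum_inter hg (h₁.disjoint_compl hH h₂ hy₁ hy₂) hg₁ hg₂, Finset.sum_pair hne] at this
  simpa using this

lemma lam_le_add_of_isSide (hw : IsEigenRatio H g lam w) (hH : H.Connected) (hl : 0 < lam)
    (hg : ∑ x, g x = 2)
    {x₁ y₁ x₂ y₂ : W} {S₁ S₂ : Finset W} (h₁ : IsSide H x₁ y₁ S₁) (h₂ : IsSide H x₂ y₂ S₂)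
    (ha₁ : H.Adj x₁ y₁) (ha₂ : H.Adj x₂ y₂) (hx₁ : x₁ ∈ S₂) (hy₁ : y₁ ∈ S₂)
    (hx₂ : x₂ ∈ S₁) (hy₂ : y₂ ∈ S₁) (hg₁ : ∑ x ∈ S₁ᶜ, g x = 1) (hg₂ : ∑ x ∈ S₂ᶜ, g x = 1) :
    lam ≤ w x₁ y₁ + w x₂ y₂ := by
  have h := hw.le_add_of_isSide hH hg h₁ h₂ ha₁ ha₂ hx₁ hy₁ hx₂ hy₂ hg₁ hg₂
  have h2 : (1 : ℝ) ≤ #(S₁ ∩ S₂) := by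
    exact_mod_cast Finset.card_pos.2 ⟨x₁, mem_inter.2 ⟨h₁.left, hx₁⟩⟩
  nlinarith

/-- An edge can be oriented so that a given other edge lies on its near side. -/
lemma exists_isSide_of_isFlat (hH : H.IsAcyclic) {x y u v : W} (h : IsFlat H lam w x y)
    (huv : H.Adj u v) (hne : s(u, v) ≠ s(x, y)) :
    ∃ x' y' S, s(x', y') = s(x, y) ∧ IsFlat H lam w x' y' ∧ IsSide H x' y' S ∧
      u ∈ S ∧ v ∈ S := by
  obtain ⟨S, hS⟩ := exists_isSide hH h.adj
  by_cases hu : u ∈ S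
  · exact ⟨x, y, S, rfl, h, hS, hu, hS.mem_of_adj huv hne hu⟩
  · refine ⟨y, x, Sᶜ, Sym2.eq_swap, h.symm, hS.compl, by simpa using hu, ?_⟩
    simpa using fun hv => hu ((hS.mem_iff_of_adj huv hne).2 hv)

/-- A flat edge drops away from every other flat edge. -/
lemma pos_of_isFlat (hw : IsEigenRatio H g lam w) (hH : H.IsTree) (hl : 0 < lam)
    (hg : ∑ x, g x = 2) {x₁ y₁ x₂ y₂ : W} {S₂ : Finset W} (h₁ : IsFlat H lam w x₁ y₁)
    (h₂ : IsFlat H lam w x₂ y₂) (hne : s(x₁, y₁) ≠ s(x₂, y₂)) (hS₂ : IsSide H x₂ y₂ S₂)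
    (hx₁ : x₁ ∈ S₂) : 0 < w x₂ y₂ := by
  have hy₁ := hS₂.mem_of_adj h₁.adj hne hx₁
  obtain ⟨x, y, S, he, hf, hS, hu, hv⟩ :=
    exists_isSide_of_isFlat hH.isAcyclic h₁ h₂.adj hne.symm
  have hmem : x ∈ S₂ ∧ y ∈ S₂ := by
    rcases Sym2.eq_iff.1 he with ⟨rfl, rfl⟩ | ⟨rfl, rfl⟩ <;> constructor <;> assumption
  have := hw.lam_le_add_of_isSide hH.connected hl hg hS hS₂ hf.adj h₂.adj hmem.1 hmem.2 hu hv
    (hw.sum_eq_one_of_isFlat hl hg hS hf).2 (hw.sum_eq_one_of_isFlat hl hg hS₂ h₂).2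
  linarith [hf.lt]

/-- All other flat edges lie on the same side of a flat edge. -/
lemma mem_iff_of_isFlat (hw : IsEigenRatio H g lam w) (hH : H.IsTree) (hl : 0 < lam)
    (hg : ∑ x, g x = 2) {x₁ y₁ x₂ y₂ x₃ y₃ : W} {S₂ : Finset W} (h₁ : IsFlat H lam w x₁ y₁)
    (h₂ : IsFlat H lam w x₂ y₂) (h₃ : IsFlat H lam w x₃ y₃) (h12 : s(x₁, y₁) ≠ s(x₂, y₂))
    (h32 : s(x₃, y₃) ≠ s(x₂, y₂)) (hS₂ : IsSide H x₂ y₂ S₂)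
    (hx₁ : x₁ ∈ S₂) : x₃ ∈ S₂ := by
  by_contra hx₃
  have ha := hw.pos_of_isFlat hH hl hg h₁ h₂ h12 hS₂ hx₁
  have hb := hw.pos_of_isFlat hH hl hg h₃ h₂.symm (by rwa [Sym2.eq_swap (a := y₂)]) hS₂.compl
    (by simpa using hx₃)
  linarith [hw.add_nonpos h₂.adj]

lemma exists_isSide_of_isFlat₂ (hw : IsEigenRatio H g lam w) (hH : H.IsTree) (hl : 0 < lam)
    (hg : ∑ x, g x = 2) {x₁ y₁ x₂ y₂ x₃ y₃ : W} (h₁ : IsFlat H lam w x₁ y₁)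
    (h₂ : IsFlat H lam w x₂ y₂) (h₃ : IsFlat H lam w x₃ y₃) (h12 : s(x₂, y₂) ≠ s(x₁, y₁))
    (h13 : s(x₃, y₃) ≠ s(x₁, y₁)) :
    ∃ x y S, s(x, y) = s(x₁, y₁) ∧ IsFlat H lam w x y ∧ IsSide H x y S ∧
      (∀ z ∈ s(x₂, y₂), z ∈ S) ∧ ∀ z ∈ s(x₃, y₃), z ∈ S := by
  obtain ⟨x, y, S, he, hf, hS, hu, hv⟩ := exists_isSide_of_isFlat hH.isAcyclic h₁ h₂.adj h12
  rw [← he] at h12 h13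
  have hx₃ := hw.mem_iff_of_isFlat hH hl hg h₂ hf h₃ h12 h13 hS hu
  have hy₃ := hS.mem_of_adj h₃.adj h13 hx₃
  refine ⟨x, y, S, he, hf, hS, ?_, ?_⟩ <;> intro z hz <;>
    rcases Sym2.mem_iff.1 hz with rfl | rfl <;> assumption

/-- There are at most two flat edges. -/
lemma not_three_isFlat (hw : IsEigenRatio H g lam w) (hH : H.IsTree) (hl : 0 < lam)
    (hl2 : lam < 1 / 2) (hg : ∑ x, g x = 2) {x₁ y₁ x₂ y₂ x₃ y₃ : W} (h₁ : IsFlat H lam w x₁ y₁)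
    (h₂ : IsFlat H lam w x₂ y₂) (h₃ : IsFlat H lam w x₃ y₃) (h12 : s(x₁, y₁) ≠ s(x₂, y₂))
    (h13 : s(x₁, y₁) ≠ s(x₃, y₃)) (h23 : s(x₂, y₂) ≠ s(x₃, y₃)) : False := by
  obtain ⟨a₁, b₁, S₁, e₁, f₁, hS₁, m12, m13⟩ :=
    hw.exists_isSide_of_isFlat₂ hH hl hg h₁ h₂ h₃ h12.symm h13.symm
  obtain ⟨a₂, b₂, S₂, e₂, f₂, hS₂, m21, m23⟩ :=
    hw.exists_isSide_of_isFlat₂ hH hl hg h₂ h₁ h₃ h12 h23.symm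
  obtain ⟨a₃, b₃, S₃, e₃, f₃, hS₃, m31, m32⟩ :=
    hw.exists_isSide_of_isFlat₂ hH hl hg h₃ h₁ h₂ h13 h23
  rw [← e₁] at m21 m31
  rw [← e₂] at m12 m32
  rw [← e₃] at m13 m23
  simp only [Sym2.mem_iff, forall_eq_or_imp, forall_eq] at m12 m13 m21 m23 m31 m32
  have d12 := hS₁.disjoint_compl hH.connected hS₂ m21.2 m12.2
  have d13 := hS₁.disjoint_compl hH.connected hS₃ m31.2 m13.2
  have d23 := hS₂.disjoint_compl hH.connected hS₃ m32.2 m23.2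
  have g₁ := (hw.sum_eq_one_of_isFlat hl hg hS₁ f₁).2
  have g₂ := (hw.sum_eq_one_of_isFlat hl hg hS₂ f₂).2
  have g₃ := (hw.sum_eq_one_of_isFlat hl hg hS₃ f₃).2
  have hM : ∑ x ∈ S₁ ∩ S₂ ∩ S₃, g x = -1 := by
    have h3 := Finset.sum_add_sum_compl (S₁ ∩ S₂ ∩ S₃) g
    rw [Finset.compl_inter, Finset.compl_inter,
      Finset.sum_union (Finset.disjoint_union_left.2 ⟨d13, d23⟩), Finset.sum_union d12] at h3
    omega
  have n12 : (a₁, b₁) ≠ (a₂, b₂) := fun h => hS₁.right (by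
    rw [(Prod.mk.inj h).2]; exact m12.2)
  have n13 : (a₁, b₁) ≠ (a₃, b₃) := fun h => hS₁.right (by
    rw [(Prod.mk.inj h).2]; exact m13.2)
  have n23 : (a₂, b₂) ≠ (a₃, b₃) := fun h => hS₂.right (by
    rw [(Prod.mk.inj h).2]; exact m23.2)
  have := hw.le_sum_cut (S₁ ∩ S₂ ∩ S₃) {(a₁, b₁), (a₂, b₂), (a₃, b₃)} fun u v => by
    simp only [mem_insert, mem_singleton, Prod.mk.injEq, mem_inter, not_and_or]
    constructor
    · rintro (⟨rfl, rfl⟩ | ⟨rfl, rfl⟩ | ⟨rfl, rfl⟩)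
      · exact ⟨⟨⟨hS₁.left, m21.1⟩, m31.1⟩, Or.inl (Or.inl hS₁.right), f₁.adj⟩
      · exact ⟨⟨⟨m12.1, hS₂.left⟩, m32.1⟩, Or.inl (Or.inr hS₂.right), f₂.adj⟩
      · exact ⟨⟨⟨m13.1, m23.1⟩, hS₃.left⟩, Or.inr hS₃.right, f₃.adj⟩
    · rintro ⟨⟨⟨hu₁, hu₂⟩, hu₃⟩, (hv | hv) | hv, huv⟩
      · exact Or.inl (hS₁.cut u hu₁ v hv huv)
      · exact Or.inr (Or.inl (hS₂.cut u hu₂ v hv huv))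
      · exact Or.inr (Or.inr (hS₃.cut u hu₃ v hv huv))
  rw [hM, Finset.sum_insert (by simpa using ⟨fun h h' => n12 (by rw [h, h']),
    fun h h' => n13 (by rw [h, h'])⟩), Finset.sum_pair n23] at this
  have h2 : (1 : ℝ) ≤ #(S₁ ∩ S₂ ∩ S₃) := by
    exact_mod_cast Finset.card_pos.2 ⟨a₁, by simp [hS₁.left, m21.1, m31.1]⟩
  push_cast at this
  nlinarith [f₁.lt, f₂.lt, f₃.lt]

end IsEigenRatio

namespace IsEigenRatio

variable {W : Type*} [Fintype W] {H : SimpleGraph W} {g : W → ℤ} {lam : ℝ} {w : W → W → ℝ}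

lemma neg_add_eq (hw : IsEigenRatio H g lam w) {x y : W} (h : H.Adj x y) :
    -(w x y + w y x) = w x y ^ 2 / (1 - w x y) := by
  have h1 : 0 < 1 - w x y := by linarith [hw.lt_one x y h]
  rw [eq_div_iff h1.ne']
  linear_combination hw.mul_eq x y h

lemma le_neg_add_of_le (hw : IsEigenRatio H g lam w) (hl : 0 < lam) {x y : W} (h : H.Adj x y)
    (hx : lam ≤ w x y) : lam ^ 2 / (1 - lam) ≤ -(w x y + w y x) := by
  have h1 : w x y < 1 := hw.lt_one x y h
  rw [hw.neg_add_eq h, div_le_div_iff₀ (by linarith) (by linarith)]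
  nlinarith [mul_nonneg (sub_nonneg.2 hx) (sub_nonneg.2 h1.le), mul_nonneg hl.le (sub_nonneg.2 hx),
    mul_nonneg (mul_nonneg hl.le (sub_nonneg.2 hx)) (sub_nonneg.2 h1.le)]

lemma lt_neg_add_of_lt (hw : IsEigenRatio H g lam w) (hl : 0 < lam) {x y : W} (h : H.Adj x y)
    (hx : lam < w x y) : lam ^ 2 / (1 - lam) < -(w x y + w y x) := by
  have h1 : w x y < 1 := hw.lt_one x y h
  rw [hw.neg_add_eq h, div_lt_div_iff₀ (by linarith) (by linarith)]
  nlinarith [mul_nonneg (sub_nonneg.2 hx.le) (sub_nonneg.2 h1.le), mul_pos hl (sub_pos.2 hx),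
    mul_nonneg (mul_nonneg hl.le (sub_nonneg.2 hx.le)) (sub_nonneg.2 h1.le)]

lemma le_neg_add_of_not_isFlat (hw : IsEigenRatio H g lam w) (hl : 0 < lam) {x y : W}
    (h : H.Adj x y) (hf : ¬ IsFlat H lam w x y) :
    lam ^ 2 / (1 - lam) ≤ -(w x y + w y x) := by
  by_cases hx : lam ≤ w x y
  · exact hw.le_neg_add_of_le hl h hx
  · by_cases hy : lam ≤ w y x
    · rw [add_comm]
      exact hw.le_neg_add_of_le hl h.symm hy
    · exact absurd ⟨h, not_le.1 hx, not_le.1 hy⟩ hf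

lemma sum_neg_add (hw : IsEigenRatio H g lam w) (hg : ∑ x, g x = 2) :
    ∑ p : W × W with H.Adj p.1 p.2, -(w p.1 p.2 + w p.2 p.1) =
      2 * (2 - Fintype.card W * lam) := by
  have h1 : ∑ x, ∑ y, (if H.Adj x y then w x y else 0) = Fintype.card W * lam - 2 := by
    rw [Finset.sum_congr rfl fun x _ => hw.sum_eq x, Finset.sum_sub_distrib]
    have : ((∑ x, g x : ℤ) : ℝ) = 2 := by exact_mod_cast hg
    push_cast at this
    simp [this]
  have h2 : ∑ x, ∑ y, (if H.Adj x y then w y x else 0) = Fintype.card W * lam - 2 := by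
    rw [← h1, Finset.sum_comm]
    simp only [H.adj_comm]
  rw [Finset.sum_neg_distrib, Finset.sum_add_distrib, Finset.sum_filter, Finset.sum_filter,
    Fintype.sum_prod_type, Fintype.sum_prod_type, h1, h2]
  ring

end IsEigenRatio

lemma SimpleGraph.IsTree.card_adj_pairs {W : Type*} [Fintype W] {H : SimpleGraph W}
    (hH : H.IsTree) : #{p : W × W | H.Adj p.1 p.2} + 2 = 2 * Fintype.card W := by
  have h1 := H.sum_degrees_eq_twice_card_edges
  have h2 := hH.card_edgeFinset
  have h3 : #{p : W × W | H.Adj p.1 p.2} = ∑ v, H.degree v := by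
    rw [Finset.card_filter, Fintype.sum_prod_type]
    refine Finset.sum_congr rfl fun v _ => ?_
    rw [← Finset.card_filter, ← SimpleGraph.card_neighborFinset_eq_degree]
    congr 1
    ext; simp
  rw [h3, h1, ← h2]
  ring

namespace IsEigenRatio

variable {W : Type*} [Fintype W] {H : SimpleGraph W} {g : W → ℤ} {lam : ℝ} {w : W → W → ℝ}

lemma card_mul_lam_le (hw : IsEigenRatio H g lam w) (hg : ∑ x, g x = 2) :
    Fintype.card W * lam ≤ 2 := by
  have h1 := hw.sum_neg_add hg
  have h2 : 0 ≤ ∑ p : W × W with H.Adj p.1 p.2, -(w p.1 p.2 + w p.2 p.1) :=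
    Finset.sum_nonneg fun p hp => by
      have := hw.add_nonpos (Finset.mem_filter.1 hp).2
      linarith
  linarith

lemma lam_lt_half (hw : IsEigenRatio H g lam w) (hg : ∑ x, g x = 2) (hk : 5 ≤ Fintype.card W) :
    lam < 1 / 2 := by
  have h1 := hw.card_mul_lam_le hg
  have h2 : (5 : ℝ) ≤ Fintype.card W := by exact_mod_cast hk
  by_contra hc
  nlinarith [not_lt.1 hc]

lemma _root_.sq_div_one_sub_eq {m u : ℝ} (hm : m < 1) (hu : u < 1) :
    u ^ 2 / (1 - u) = m ^ 2 / (1 - m) + m * (2 - m) / (1 - m) ^ 2 * (u - m) +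
      (u - m) ^ 2 / ((1 - u) * (1 - m) ^ 2) := by
  have h1 : 1 - m ≠ 0 := by linarith
  have h2 : 1 - u ≠ 0 := by linarith
  field_simp
  ring

lemma _root_.sq_div_two_sub_le {lam u v : ℝ} (hl : 0 < lam) (hl1 : lam < 1) (hu : u < 1)
    (hv : v < 1) (huv : lam ≤ u + v) :
    lam ^ 2 / (2 - lam) ≤ u ^ 2 / (1 - u) + v ^ 2 / (1 - v) ∧
      (u ^ 2 / (1 - u) + v ^ 2 / (1 - v) ≤ lam ^ 2 / (2 - lam) →
        u = lam / 2 ∧ v = lam / 2) := by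
  have hm : lam / 2 < 1 := by linarith
  have h0 : lam ^ 2 / (2 - lam) = 2 * ((lam / 2) ^ 2 / (1 - lam / 2)) := by
    have h1 : 2 - lam ≠ 0 := by linarith
    have h2 : 1 - lam / 2 ≠ 0 := by linarith
    field_simp
  rw [sq_div_one_sub_eq hm hu, sq_div_one_sub_eq hm hv, h0]
  have hc : 0 < lam / 2 * (2 - lam / 2) / (1 - lam / 2) ^ 2 := by
    have : 0 < 1 - lam / 2 := by linarith
    have : 0 < 2 - lam / 2 := by linarith
    positivity
  set c := lam / 2 * (2 - lam / 2) / (1 - lam / 2) ^ 2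
  have hu1 : 0 < (1 - u) * (1 - lam / 2) ^ 2 :=
    mul_pos (by linarith) (pow_pos (by linarith) 2)
  have hv1 : 0 < (1 - v) * (1 - lam / 2) ^ 2 :=
    mul_pos (by linarith) (pow_pos (by linarith) 2)
  have hun := div_nonneg (sq_nonneg (u - lam / 2)) hu1.le
  have hvn := div_nonneg (sq_nonneg (v - lam / 2)) hv1.le
  have hcn := mul_nonneg hc.le (sub_nonneg.2 huv)
  have hcn' : c * (u + v - lam) = c * (u - lam / 2) + c * (v - lam / 2) := by ring
  refine ⟨by linarith, fun h => ?_⟩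
  have hu0 : (u - lam / 2) ^ 2 / ((1 - u) * (1 - lam / 2) ^ 2) = 0 := by linarith
  have hv0 : (v - lam / 2) ^ 2 / ((1 - v) * (1 - lam / 2) ^ 2) = 0 := by linarith
  rw [div_eq_zero_iff, or_iff_left hu1.ne', sq_eq_zero_iff] at hu0
  rw [div_eq_zero_iff, or_iff_left hv1.ne', sq_eq_zero_iff] at hv0
  constructor <;> linarith

/-- If the eigenvalue is large enough, there are exactly two flat edges, and all estimates are
sharp. -/
lemma exists_isFlat_pair (hw : IsEigenRatio H g lam w) (hH : H.IsTree) (hl : 0 < lam)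
    (hg : ∑ x, g x = 2) (hk : 5 ≤ Fintype.card W)
    (hle : 2 - Fintype.card W * lam ≤
      (Fintype.card W - 3) * (lam ^ 2 / (1 - lam)) + lam ^ 2 / (2 - lam)) :
    ∃ x₁ y₁ x₂ y₂ S₁ S₂, IsFlat H lam w x₁ y₁ ∧ IsFlat H lam w x₂ y₂ ∧
      IsSide H x₁ y₁ S₁ ∧ IsSide H x₂ y₂ S₂ ∧ x₁ ∈ S₂ ∧ y₁ ∈ S₂ ∧ x₂ ∈ S₁ ∧ y₂ ∈ S₁ ∧
      w x₁ y₁ = lam / 2 ∧ w x₂ y₂ = lam / 2 ∧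
      ∀ x y, H.Adj x y → s(x, y) ≠ s(x₁, y₁) → s(x, y) ≠ s(x₂, y₂) →
        -(w x y + w y x) = lam ^ 2 / (1 - lam) := by
  have hl2 := hw.lam_lt_half hg hk
  set ρ := lam ^ 2 / (1 - lam) with hρ
  set τ := lam ^ 2 / (2 - lam) with hτ
  have hτρ : τ < ρ := by
    rw [hτ, hρ, div_lt_div_iff₀ (by linarith) (by linarith)]
    nlinarith [sq_pos_of_pos hl]
  have hρ0 : 0 < ρ := div_pos (by positivity) (by linarith)
  set P : Finset (W × W) := {p : W × W | H.Adj p.1 p.2} with hP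
  have hsum : 4 * ρ - 2 * τ ≤ ∑ p ∈ P, (ρ - -(w p.1 p.2 + w p.2 p.1)) := by
    have hc : (#P : ℝ) + 2 = 2 * Fintype.card W := by exact_mod_cast hH.card_adj_pairs
    rw [Finset.sum_sub_distrib, hw.sum_neg_add hg, Finset.sum_const, nsmul_eq_mul,
      eq_sub_of_add_eq hc]
    linarith
  have hnon : ∀ p ∈ P, ¬ IsFlat H lam w p.1 p.2 → ρ - -(w p.1 p.2 + w p.2 p.1) ≤ 0 :=
    fun p hp hf => sub_nonpos.2 (hw.le_neg_add_of_not_isFlat hl (Finset.mem_filter.1 hp).2 hf)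
  have hbound : ∀ Q ⊆ P, (∀ p ∈ P, p ∉ Q → ¬ IsFlat H lam w p.1 p.2) →
      4 * ρ - 2 * τ ≤ ∑ p ∈ Q, (ρ - -(w p.1 p.2 + w p.2 p.1)) := fun Q hQ h => by
    rw [← Finset.sum_sdiff hQ] at hsum
    have := Finset.sum_nonpos fun p (hp : p ∈ P \ Q) =>
      hnon p (Finset.mem_sdiff.1 hp).1 (h p (Finset.mem_sdiff.1 hp).1 (Finset.mem_sdiff.1 hp).2)
    linarith
  obtain ⟨x₁, y₁, h₁⟩ : ∃ x₁ y₁, IsFlat H lam w x₁ y₁ := by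
    by_contra! hc
    have := hbound ∅ (Finset.empty_subset _) fun p _ _ => hc p.1 p.2
    rw [Finset.sum_empty] at this
    linarith
  have n₁ : (x₁, y₁) ≠ (y₁, x₁) := fun h => h₁.adj.ne (Prod.mk.inj h).1
  obtain ⟨x₂, y₂, h₂, hne⟩ : ∃ x₂ y₂, IsFlat H lam w x₂ y₂ ∧ s(x₁, y₁) ≠ s(x₂, y₂) := by
    by_contra! hc
    have := hbound {(x₁, y₁), (y₁, x₁)} ?_ ?_
    · rw [Finset.sum_pair n₁] at this
      have := hw.add_nonpos h₁.adj
      linarith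
    · rintro p hp
      simp only [mem_insert, mem_singleton] at hp
      rcases hp with rfl | rfl <;> simp [hP, h₁.adj, h₁.adj.symm]
    · rintro ⟨x, y⟩ _ hp hf
      apply hp
      have := hc x y hf
      rw [eq_comm, Sym2.eq_iff] at this
      simpa using this
  have n₂ : (x₂, y₂) ≠ (y₂, x₂) := fun h => h₂.adj.ne (Prod.mk.inj h).1
  set Q : Finset (W × W) := {(x₁, y₁), (y₁, x₁), (x₂, y₂), (y₂, x₂)} with hQ
  have hQmem : ∀ x y, (x, y) ∈ Q ↔ s(x, y) = s(x₁, y₁) ∨ s(x, y) = s(x₂, y₂) := fun x y => by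
    simp only [hQ, mem_insert, mem_singleton, Sym2.eq_iff, Prod.mk.injEq, or_assoc]
  have hQP : Q ⊆ P := by
    rintro p hp
    simp only [hQ, mem_insert, mem_singleton] at hp
    rcases hp with rfl | rfl | rfl | rfl <;> simp [hP, h₁.adj, h₁.adj.symm, h₂.adj, h₂.adj.symm]
  have hQflat : ∀ p ∈ P, p ∉ Q → ¬ IsFlat H lam w p.1 p.2 := by
    rintro ⟨x, y⟩ _ hp hf
    rw [hQmem, not_or] at hp
    exact hw.not_three_isFlat hH hl hl2 hg h₁ h₂ hf hne (Ne.symm hp.1) (Ne.symm hp.2)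
  have hQsum : ∑ p ∈ Q, (ρ - -(w p.1 p.2 + w p.2 p.1)) =
      4 * ρ - 2 * (-(w x₁ y₁ + w y₁ x₁) + -(w x₂ y₂ + w y₂ x₂)) := by
    rw [Ne, Sym2.eq_iff] at hne
    rw [hQ, Finset.sum_insert, Finset.sum_insert, Finset.sum_pair n₂]
    · ring
    · simp only [mem_insert, mem_singleton, Prod.mk.injEq]; tauto
    · simp only [mem_insert, mem_singleton, Prod.mk.injEq]
      have := h₁.adj.ne
      tauto
  have hfin : -(w x₁ y₁ + w y₁ x₁) + -(w x₂ y₂ + w y₂ x₂) ≤ τ := by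
    have := hbound Q hQP hQflat
    rw [hQsum] at this
    linarith
  obtain ⟨a₂, b₂, S₂, e₂, f₂, hS₂, hx₁, hy₁⟩ :=
    exists_isSide_of_isFlat hH.isAcyclic h₂ h₁.adj hne
  obtain ⟨a₁, b₁, S₁, e₁, f₁, hS₁, hx₂, hy₂⟩ :=
    exists_isSide_of_isFlat hH.isAcyclic h₁ h₂.adj hne.symm
  have m₁ : a₁ ∈ S₂ ∧ b₁ ∈ S₂ := by
    rcases Sym2.eq_iff.1 e₁ with ⟨rfl, rfl⟩ | ⟨rfl, rfl⟩ <;> constructor <;> assumption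
  have m₂ : a₂ ∈ S₁ ∧ b₂ ∈ S₁ := by
    rcases Sym2.eq_iff.1 e₂ with ⟨rfl, rfl⟩ | ⟨rfl, rfl⟩ <;> constructor <;> assumption
  have s₁ : -(w x₁ y₁ + w y₁ x₁) = -(w a₁ b₁ + w b₁ a₁) := by
    rcases Sym2.eq_iff.1 e₁ with ⟨rfl, rfl⟩ | ⟨rfl, rfl⟩ <;> ring
  have s₂ : -(w x₂ y₂ + w y₂ x₂) = -(w a₂ b₂ + w b₂ a₂) := by
    rcases Sym2.eq_iff.1 e₂ with ⟨rfl, rfl⟩ | ⟨rfl, rfl⟩ <;> ring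
  have hadd := hw.lam_le_add_of_isSide hH.connected hl hg hS₁ hS₂ f₁.adj f₂.adj m₁.1 m₁.2
    m₂.1 m₂.2 (hw.sum_eq_one_of_isFlat hl hg hS₁ f₁).2 (hw.sum_eq_one_of_isFlat hl hg hS₂ f₂).2
  obtain ⟨hτle, hτeq⟩ := sq_div_two_sub_le hl (by linarith) (hw.lt_one _ _ f₁.adj)
    (hw.lt_one _ _ f₂.adj) hadd
  rw [← hw.neg_add_eq f₁.adj, ← hw.neg_add_eq f₂.adj, ← s₁, ← s₂] at hτle hτeq
  refine ⟨a₁, b₁, a₂, b₂, S₁, S₂, f₁, f₂, hS₁, hS₂, m₁.1, m₁.2, m₂.1, m₂.2, (hτeq hfin).1,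
    (hτeq hfin).2, fun x y hxy hn1 hn2 => ?_⟩
  rw [e₁] at hn1
  rw [e₂] at hn2
  have hnonpos : ∀ p ∈ P \ Q, ρ - -(w p.1 p.2 + w p.2 p.1) ≤ 0 := fun p hp =>
    hnon p (Finset.mem_sdiff.1 hp).1
      (hQflat p (Finset.mem_sdiff.1 hp).1 (Finset.mem_sdiff.1 hp).2)
  have hzero : ∑ p ∈ P \ Q, (ρ - -(w p.1 p.2 + w p.2 p.1)) = 0 := by
    refine le_antisymm (Finset.sum_nonpos hnonpos) ?_
    rw [← Finset.sum_sdiff hQP, hQsum] at hsum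
    linarith
  have hmem : (x, y) ∈ P \ Q := by
    rw [Finset.mem_sdiff, hQmem, not_or]
    exact ⟨by simpa [hP] using hxy, hn1, hn2⟩
  have := (Finset.sum_eq_zero_iff_of_nonpos hnonpos).1 hzero (x, y) hmem
  simp only at this
  linarith

end IsEigenRatio

namespace IsEigenRatio

variable {W : Type*} [Fintype W] {H : SimpleGraph W} {g : W → ℤ} {lam : ℝ} {w : W → W → ℝ}

lemma eq_lam_or_eq_lam (hw : IsEigenRatio H g lam w) (hl : 0 < lam) {x y : W} (h : H.Adj x y)
    (heq : -(w x y + w y x) = lam ^ 2 / (1 - lam)) :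
    (lam ≤ w x y → w x y = lam) ∧ (lam ≤ w y x → w y x = lam) := by
  refine ⟨fun h1 => ?_, fun h1 => ?_⟩
  · rcases h1.eq_or_lt with h2 | h2
    · exact h2.symm
    · exact absurd heq (hw.lt_neg_add_of_lt hl h h2).ne'
  · rcases h1.eq_or_lt with h2 | h2
    · exact h2.symm
    · rw [add_comm] at heq
      exact absurd heq (hw.lt_neg_add_of_lt hl h.symm h2).ne'

/-- An edge with minimal relative difference and non-positive potential behind it is pendant. -/
lemma pendant_of_sum_nonpos (hw : IsEigenRatio H g lam w) (hl : 0 < lam) {x y : W} {S : Finset W}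
    (hS : IsSide H x y S) (h : H.Adj x y) (hg : ∑ x ∈ S, g x ≤ 0)
    (heq : lam ≤ w x y → w x y = lam) : g x = 0 ∧ ∀ u, H.Adj x u → u = y := by
  have h0 := heq (hw.lt_of_sum_nonpos hl hS h hg)
  have h1 := hw.le_of_isSide hS h
  have h2 : (1 : ℝ) ≤ #S := by exact_mod_cast Finset.card_pos.2 ⟨x, hS.left⟩
  have h3 : ((∑ x ∈ S, g x : ℤ) : ℝ) ≤ 0 := by exact_mod_cast hg
  have h4 : (#S : ℝ) ≤ 1 := by
    by_contra hc
    nlinarith [not_le.1 hc]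
  have h5 : #S ≤ 1 := by exact_mod_cast h4
  have hSx : S = {x} := by
    rw [Finset.eq_singleton_iff_unique_mem]
    exact ⟨hS.left, fun z hz => Finset.card_le_one.1 h5 z hz x hS.left⟩
  subst hSx
  refine ⟨?_, fun u hu => ?_⟩
  · rw [Finset.sum_singleton] at *
    have : (-1 : ℝ) < g x := by
      rw [Finset.card_singleton] at h1
      push_cast at h1
      linarith
    have : -1 < g x := by exact_mod_cast this
    omega
  · refine (hS.cut x hS.left u ?_ hu).2
    simpa using hu.ne'

/-- If the eigenvalue is large enough, the tree consists of two stars with equally many rays whose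
centres have a further common neighbour. -/
lemma exists_double_star (hw : IsEigenRatio H g lam w) (hH : H.IsTree) (hl : 0 < lam)
    (hg : ∑ x, g x = 2) (hk : 5 ≤ Fintype.card W)
    (hle : 2 - Fintype.card W * lam ≤
      (Fintype.card W - 3) * (lam ^ 2 / (1 - lam)) + lam ^ 2 / (2 - lam)) :
    ∃ v y₁ y₂, H.Adj v y₁ ∧ H.Adj v y₂ ∧ y₁ ≠ y₂ ∧ g v = 0 ∧ g y₁ = 1 ∧ g y₂ = 1 ∧
      (∀ z, z ≠ v → z ≠ y₁ → z ≠ y₂ → g z = 0 ∧ (H.Adj y₁ z ∨ H.Adj y₂ z)) ∧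
      2 * #{z | H.Adj y₁ z ∧ z ≠ v} + 3 = Fintype.card W ∧
      2 * #{z | H.Adj y₂ z ∧ z ≠ v} + 3 = Fintype.card W := by
  have hl2 := hw.lam_lt_half hg hk
  obtain ⟨v, y₁, x₂, y₂, S₁, S₂, f₁, f₂, hS₁, hS₂, hx₁, hy₁, hx₂, hy₂, w₁, w₂, hρ⟩ :=
    hw.exists_isFlat_pair hH hl hg hk hle
  have g₁ := (hw.sum_eq_one_of_isFlat hl hg hS₁ f₁).2
  have g₂ := (hw.sum_eq_one_of_isFlat hl hg hS₂ f₂).2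
  have hdisj := hS₁.disjoint_compl hH.connected hS₂ hy₁ hy₂
  have hMcard : #(S₁ ∩ S₂) ≤ 1 := by
    have := hw.le_add_of_isSide hH.connected hg hS₁ hS₂ f₁.adj f₂.adj hx₁ hy₁ hx₂ hy₂ g₁ g₂
    rw [w₁, w₂, add_halves] at this
    have h1 : (#(S₁ ∩ S₂) : ℝ) ≤ 1 := by
      by_contra hc
      nlinarith [not_le.1 hc]
    exact_mod_cast h1
  have hvM : v ∈ S₁ ∩ S₂ := mem_inter.2 ⟨hS₁.left, hx₁⟩
  have hM : S₁ ∩ S₂ = {v} := Finset.eq_singleton_iff_unique_mem.2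
    ⟨hvM, fun z hz => Finset.card_le_one.1 hMcard z hz v hvM⟩
  obtain rfl : x₂ = v := by
    have : x₂ ∈ S₁ ∩ S₂ := mem_inter.2 ⟨hx₂, hS₂.left⟩
    simpa [hM] using this
  have hy : y₁ ≠ y₂ := fun h => hS₁.right (h ▸ hy₂)
  have hgv : g x₂ = 0 := by
    have := sum_inter hg hdisj g₁ g₂
    rwa [hM, Finset.sum_singleton] at this
  -- no edge within the far side of `y` separates the potential evenly
  have key : ∀ y' S' x y Sx, IsFlat H lam w x₂ y' → IsSide H x₂ y' S' → w x₂ y' = lam / 2 →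
      H.Adj x y → s(x, y) ≠ s(x₂, y') → -(w x y + w y x) = lam ^ 2 / (1 - lam) →
      IsSide H x y Sx → x ∉ S' → ∑ z ∈ Sx, g z = 1 → ∑ z ∈ Sxᶜ, g z = 1 → False := by
    intro y' S' x y Sx f' hS' hw' hxy hne hφ hSx hx hgx hgx'
    have hy : y ∉ S' := fun h => hx ((hS'.mem_iff_of_adj hxy hne).2 h)
    have hneg : w y' x₂ < 0 := by
      have := hw.add_nonpos f'.adj
      linarith
    have hpq := hw.eq_lam_or_eq_lam hl hxy hφ
    have hgS := (hw.sum_eq_one_of_isFlat hl hg hS' f').1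
    by_cases hv : x₂ ∈ Sx
    · have hv' := hSx.mem_of_adj f'.adj hne.symm hv
      have := hw.lam_le_add_of_isSide hH.connected hl hg hSx hS'.compl hxy f'.adj.symm
        (by simpa using hx) (by simpa using hy) hv' hv hgx' (by simpa using hgS)
      linarith [hpq.1 (by linarith)]
    · have hv' : y' ∉ Sx := fun h => hv ((hSx.mem_iff_of_adj f'.adj hne.symm).2 h)
      have := hw.lam_le_add_of_isSide hH.connected hl hg hSx.compl hS'.compl hxy.symm f'.adj.symm
        (by simpa using hy) (by simpa using hx) (by simpa using hv') (by simpa using hv)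
        (by simpa using hgx) (by simpa using hgS)
      linarith [hpq.2 (by linarith)]
  have hpend : ∀ x y, H.Adj x y → s(x, y) ≠ s(x₂, y₁) → s(x, y) ≠ s(x₂, y₂) →
      (g x = 0 ∧ ∀ u, H.Adj x u → u = y) ∨ (g y = 0 ∧ ∀ u, H.Adj y u → u = x) := by
    intro x y hxy hn₁ hn₂
    have hφ := hρ x y hxy hn₁ hn₂
    have hpq := hw.eq_lam_or_eq_lam hl hxy hφ
    obtain ⟨Sx, hSx⟩ := exists_isSide hH.isAcyclic hxy
    have htot := Finset.sum_add_sum_compl Sx g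
    by_cases h1 : ∑ z ∈ Sx, g z ≤ 0
    · exact Or.inl (hw.pendant_of_sum_nonpos hl hSx hxy h1 hpq.1)
    by_cases h2 : ∑ z ∈ Sxᶜ, g z ≤ 0
    · exact Or.inr (hw.pendant_of_sum_nonpos hl hSx.compl hxy.symm h2 hpq.2)
    exfalso
    have hg1 : ∑ z ∈ Sx, g z = 1 := by omega
    have hg2 : ∑ z ∈ Sxᶜ, g z = 1 := by omega
    by_cases hx1 : x ∈ S₁
    · by_cases hx2 : x ∈ S₂
      · have hxv : x ∈ S₁ ∩ S₂ := mem_inter.2 ⟨hx1, hx2⟩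
        have hyv : y ∈ S₁ ∩ S₂ := mem_inter.2
          ⟨hS₁.mem_of_adj hxy hn₁ hx1, hS₂.mem_of_adj hxy hn₂ hx2⟩
        rw [hM, Finset.mem_singleton] at hxv hyv
        exact hxy.ne (hxv.trans hyv.symm)
      · exact key y₂ S₂ x y Sx f₂ hS₂ w₂ hxy hn₂ hφ hSx hx2 hg1 hg2
    · exact key y₁ S₁ x y Sx f₁ hS₁ w₁ hxy hn₁ hφ hSx hx1 hg1 hg2
  have hstar : ∀ y' S' y'', IsFlat H lam w x₂ y' → IsSide H x₂ y' S' → y'' ∈ S' →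
      (∀ x y, H.Adj x y → s(x, y) ≠ s(x₂, y') → s(x, y) ≠ s(x₂, y'') →
      (g x = 0 ∧ ∀ u, H.Adj x u → u = y) ∨ (g y = 0 ∧ ∀ u, H.Adj y u → u = x)) →
      ∀ z, H.Adj y' z → z ≠ x₂ → z ∉ S' ∧ g z = 0 ∧ ∀ u, H.Adj z u → u = y' := by
    intro y' S' y'' f' hS' hy'' hp z hz hzx
    have hzS : z ∉ S' := by
      have := hS'.compl.mem_of_adj hz (by
        rw [Ne, Sym2.eq_iff]
        rintro (⟨-, h⟩ | ⟨h, h'⟩)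
        · exact hzx h
        · exact f'.adj.ne h.symm) hS'.compl.left
      simpa using this
    refine ⟨hzS, ?_⟩
    have hn₁ : s(y', z) ≠ s(x₂, y') := by
      rw [Ne, Sym2.eq_iff]
      rintro (⟨h, -⟩ | ⟨-, h⟩)
      · exact f'.adj.ne h.symm
      · exact hzx h
    have hn₂ : s(y', z) ≠ s(x₂, y'') := by
      rw [Ne, Sym2.eq_iff]
      rintro (⟨h, -⟩ | ⟨h, -⟩)
      · exact f'.adj.ne h.symm
      · exact hS'.right (h ▸ hy'')
    rcases hp y' z hz hn₁ hn₂ with h | h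
    · exact absurd ((h.2 x₂ f'.adj.symm).symm) hzx
    · exact h
  have hstar₁ := hstar y₁ S₁ y₂ f₁ hS₁ hy₂ hpend
  have hstar₂ := hstar y₂ S₂ y₁ f₂ hS₂ hy₁
    fun x y h h1 h2 => hpend x y h h2 h1
  have hv : ∀ u, H.Adj x₂ u → u = y₁ ∨ u = y₂ := by
    intro u hu
    by_cases h1 : u ∈ S₁
    · by_cases h2 : u ∈ S₂
      · have : u ∈ S₁ ∩ S₂ := mem_inter.2 ⟨h1, h2⟩
        rw [hM, Finset.mem_singleton] at this
        exact absurd this hu.ne'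
      · exact Or.inr (hS₂.cut x₂ hS₂.left u h2 hu).2
    · exact Or.inl (hS₁.cut x₂ hS₁.left u h1 hu).2
  have hcover : ∀ z, z = x₂ ∨ z = y₁ ∨ z = y₂ ∨ H.Adj y₁ z ∨ H.Adj y₂ z := by
    refine hH.connected.mem_of_adj_closed
      (X := {z | z = x₂ ∨ z = y₁ ∨ z = y₂ ∨ H.Adj y₁ z ∨ H.Adj y₂ z}) ?_ (Or.inl rfl)
    rintro u t hut (rfl | rfl | rfl | h | h)
    · rcases hv t hut with rfl | rfl <;> simp
    · simp [hut]
    · simp [hut]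
    · by_cases hu : u = x₂
      · subst hu
        rcases hv t hut with rfl | rfl <;> simp
      · simp [(hstar₁ u h hu).2.2 t hut]
    · by_cases hu : u = x₂
      · subst hu
        rcases hv t hut with rfl | rfl <;> simp
      · simp [(hstar₂ u h hu).2.2 t hut]
  have hset : ∀ y' S' y'' S'', IsSide H x₂ y' S' → Disjoint S'ᶜ S''ᶜ → y'' ∈ S' →
      (∀ z, H.Adj y' z → z ≠ x₂ → z ∉ S' ∧ g z = 0 ∧ ∀ u, H.Adj z u → u = y') →
      (∀ z, H.Adj y'' z → z ≠ x₂ → z ∉ S'' ∧ g z = 0 ∧ ∀ u, H.Adj z u → u = y'') →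
      (∀ z, z = x₂ ∨ z = y' ∨ z = y'' ∨ H.Adj y' z ∨ H.Adj y'' z) →
      ∑ z ∈ S'ᶜ, g z = 1 →
      S'ᶜ = insert y' ({z | H.Adj y' z ∧ z ≠ x₂} : Finset W) ∧ g y' = 1 := by
    intro y' S' y'' S'' hS' hd hy'' h1 h2 hc hgs
    have he : S'ᶜ = insert y' ({z | H.Adj y' z ∧ z ≠ x₂} : Finset W) := by
      ext z
      simp only [mem_insert, mem_filter, mem_univ, true_and]
      constructor
      · intro hz
        have hzx : z ≠ x₂ := by
          rintro rfl
          exact absurd hS'.left (by simpa using hz)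
        rcases hc z with h | h | h | h | h
        · exact absurd h hzx
        · exact Or.inl h
        · subst h
          exact absurd hy'' (by simpa using hz)
        · exact Or.inr ⟨h, hzx⟩
        · exact absurd (by simpa using (h2 z h hzx).1) (Finset.disjoint_left.1 hd hz)
      · rintro (rfl | ⟨h, hzx⟩)
        · exact hS'.compl.left
        · simpa using (h1 z h hzx).1
    refine ⟨he, ?_⟩
    rw [he, Finset.sum_insert (by simp), Finset.sum_eq_zero, add_zero] at hgs
    · exact hgs
    · intro z hz
      simp only [mem_filter, mem_univ, true_and] at hz
      exact (h1 z hz.1 hz.2).2.1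
  obtain ⟨hset₁, hg₁⟩ := hset y₁ S₁ y₂ S₂ hS₁ hdisj hy₂ hstar₁ hstar₂ hcover g₁
  obtain ⟨hset₂, hg₂⟩ := hset y₂ S₂ y₁ S₁ hS₂ hdisj.symm hy₁ hstar₂ hstar₁
    (fun z => by rcases hcover z with h | h | h | h | h <;> simp [h]) g₂
  have hcard : #({z | H.Adj y₁ z ∧ z ≠ x₂} : Finset W) +
      #({z | H.Adj y₂ z ∧ z ≠ x₂} : Finset W) + 3 = Fintype.card W := by
    have h1 := Finset.card_add_card_compl (S₁ ∩ S₂)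
    rw [Finset.compl_inter, Finset.card_union_of_disjoint hdisj, hset₁, hset₂, hM,
      Finset.card_insert_of_notMem (by simp), Finset.card_insert_of_notMem (by simp),
      Finset.card_singleton] at h1
    omega
  -- the eigenvalue equation at a centre determines its number of rays
  have hdeg : ∀ y', IsFlat H lam w x₂ y' → w x₂ y' = lam / 2 → g y' = 1 →
      (∀ z, H.Adj y' z → z ≠ x₂ → g z = 0 ∧ ∀ u, H.Adj z u → u = y') →
      #({z | H.Adj y' z ∧ z ≠ x₂} : Finset W) * (lam / (1 - lam)) =
        1 - lam + (1 - 1 / (1 - lam / 2)) := by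
    intro y' f' hw' hgy hz
    have hl1 : 1 - lam ≠ 0 := by linarith
    have hl2 : 1 - lam / 2 ≠ 0 := by linarith
    have hray : ∀ z ∈ ({z | H.Adj y' z ∧ z ≠ x₂} : Finset W), w y' z = -(lam / (1 - lam)) := by
      intro z hz'
      simp only [mem_filter, mem_univ, true_and] at hz'
      obtain ⟨h0, h1⟩ := hz z hz'.1 hz'.2
      have h2 := hw.sum_eq z
      rw [Finset.sum_eq_single y', if_pos hz'.1.symm, h0] at h2
      · have h3 := hw.mul_eq y' z hz'.1
        rw [h2] at h3
        push_cast at h3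
        field_simp
        linarith
      · intro u _ hu
        rw [if_neg fun h => hu (h1 u h)]
      · simp
    have hback : w y' x₂ = 1 - 1 / (1 - lam / 2) := by
      have h3 := hw.mul_eq _ _ f'.adj
      rw [hw'] at h3
      rw [eq_sub_iff_add_eq, ← eq_sub_iff_add_eq', div_eq_iff hl2]
      linarith
    have h4 := hw.sum_eq y'
    rw [← Finset.sum_filter] at h4
    have h5 : ({z | H.Adj y' z} : Finset W) = insert x₂ ({z | H.Adj y' z ∧ z ≠ x₂} : Finset W) := by
      ext z
      simp only [mem_insert, mem_filter, mem_univ, true_and]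
      have := f'.adj.symm
      by_cases h : z = x₂ <;> simp [h, this]
    rw [h5, Finset.sum_insert (by simp), Finset.sum_congr rfl hray, Finset.sum_const, nsmul_eq_mul,
      hback, hgy] at h4
    push_cast at h4
    linarith
  have hd₁ := hdeg y₁ f₁ w₁ hg₁ fun z h h' => (hstar₁ z h h').2
  have hd₂ := hdeg y₂ f₂ w₂ hg₂ fun z h h' => (hstar₂ z h h').2
  have hdd : #({z | H.Adj y₁ z ∧ z ≠ x₂} : Finset W) = #({z | H.Adj y₂ z ∧ z ≠ x₂} : Finset W) := by
    have h1 : lam / (1 - lam) ≠ 0 := (div_pos hl (by linarith)).ne'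
    exact_mod_cast mul_right_cancel₀ h1 (hd₁.trans hd₂.symm)
  refine ⟨x₂, y₁, y₂, f₁.adj, f₂.adj, hy, hgv, hg₁, hg₂, fun z h1 h2 h3 => ?_, by omega, by omega⟩
  rcases hcover z with h | h | h | h | h
  · exact absurd h h1
  · exact absurd h h2
  · exact absurd h h3
  · exact ⟨(hstar₁ z h h1).2.1, Or.inl h⟩
  · exact ⟨(hstar₂ z h h1).2.1, Or.inr h⟩

end IsEigenRatio

/-- The (unsigned) graph Laplacian. -/
noncomputable def graphLap {V : Type*} [Fintype V] (G : SimpleGraph V) (f : V → ℝ) (x : V) : ℝ :=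
  ∑ y, if G.Adj x y then f x - f y else 0

section Dirichlet

variable {V : Type*} [Fintype V] {G : SimpleGraph V} {B : Finset V}

/-- Summation by parts. -/
lemma sum_mul_graphLap (f φ : V → ℝ) :
    (∑ x, ∑ y, if G.Adj x y then (f x - f y) * (φ x - φ y) else 0) / 2 =
      ∑ x, φ x * graphLap G f x := by
  have h1 : ∑ x, ∑ y, (if G.Adj x y then φ x * (f x - f y) else 0) =
      ∑ x, φ x * graphLap G f x := by
    simp only [graphLap, Finset.mul_sum, mul_ite, mul_zero]
  have h2 : ∑ x, ∑ y, (if G.Adj x y then φ y * (f y - f x) else 0) =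
      ∑ x, φ x * graphLap G f x := by
    rw [← h1, Finset.sum_comm]
    simp only [G.adj_comm]
  have h3 : ∑ x, ∑ y, (if G.Adj x y then (f x - f y) * (φ x - φ y) else 0) =
      ∑ x, ∑ y, (if G.Adj x y then φ x * (f x - f y) else 0) +
      ∑ x, ∑ y, (if G.Adj x y then φ y * (f y - f x) else 0) := by
    simp only [← Finset.sum_add_distrib]
    refine Finset.sum_congr rfl fun x _ => Finset.sum_congr rfl fun y _ => ?_
    split_ifs <;> ring
  rw [h3, h1, h2]
  ring

lemma dirichletForm_eq_sum (f : V → ℝ) : dirichletForm G f = ∑ x, f x * graphLap G f x := by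
  rw [← sum_mul_graphLap, dirichletForm]
  simp only [sq]

lemma dirichletForm_nonneg (f : V → ℝ) : 0 ≤ dirichletForm G f := by
  refine div_nonneg (Finset.sum_nonneg fun x _ => Finset.sum_nonneg fun y _ => ?_) zero_le_two
  split_ifs <;> positivity

lemma dirichletForm_add_smul (f φ : V → ℝ) (t : ℝ) :
    dirichletForm G (f + t • φ) =
      dirichletForm G f + 2 * t * ∑ x, φ x * graphLap G f x + t ^ 2 * dirichletForm G φ := by
  rw [← sum_mul_graphLap]
  simp only [dirichletForm, mul_div_assoc', Finset.mul_sum, ← add_div, ← Finset.sum_add_distrib]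
  congr 1
  refine Finset.sum_congr rfl fun x _ => ?_
  refine Finset.sum_congr rfl fun y _ => ?_
  simp only [Pi.add_apply, Pi.smul_apply, smul_eq_mul]
  split_ifs <;> ring

lemma dirichletForm_abs_le (f : V → ℝ) : dirichletForm G (fun x => |f x|) ≤ dirichletForm G f := by
  refine div_le_div_of_nonneg_right
    (Finset.sum_le_sum fun x _ => Finset.sum_le_sum fun y _ => ?_) zero_le_two
  split_ifs
  · exact sq_le_sq.2 (abs_abs_sub_abs_le_abs_sub _ _)
  · exact le_rfl

lemma dirichletForm_smul (c : ℝ) (f : V → ℝ) :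
    dirichletForm G (c • f) = c ^ 2 * dirichletForm G f := by
  simp only [dirichletForm, mul_div_assoc', Finset.mul_sum]
  congr 1
  refine Finset.sum_congr rfl fun x _ => Finset.sum_congr rfl fun y _ => ?_
  simp only [Pi.smul_apply, smul_eq_mul]
  split_ifs <;> ring

lemma sum_sq_pos {f : V → ℝ} (hf : ∀ x ∈ B, f x = 0) (h : f ≠ 0) : 0 < ∑ x ∈ Bᶜ, f x ^ 2 := by
  obtain ⟨x, hx⟩ := Function.ne_iff.1 h
  refine Finset.sum_pos' (fun _ _ => sq_nonneg _) ⟨x, ?_, ?_⟩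
  · rw [mem_compl]
    exact fun hB => hx (hf x hB)
  · exact sq_pos_of_ne_zero hx

/-- The first Dirichlet eigenvalue is attained by a nonnegative function. -/
lemma exists_minimizer (hB : Bᶜ.Nonempty) :
    ∃ f : V → ℝ, (∀ x ∈ B, f x = 0) ∧ (∀ x, 0 ≤ f x) ∧ f ≠ 0 ∧
      dirichletForm G f = lambda1 G B * ∑ x ∈ Bᶜ, f x ^ 2 ∧
      ∀ φ : V → ℝ, (∀ x ∈ B, φ x = 0) →
        lambda1 G B * ∑ x ∈ Bᶜ, φ x ^ 2 ≤ dirichletForm G φ := by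
  set K : Set (V → ℝ) := {f | (∀ x ∈ B, f x = 0) ∧ ∑ x ∈ Bᶜ, f x ^ 2 = 1} with hK
  have hclosed : IsClosed K := by
    have h1 : IsClosed {f : V → ℝ | ∀ x ∈ B, f x = 0} := by
      simp only [Set.ofPred_forall]
      exact isClosed_iInter fun x => isClosed_iInter fun _ =>
        isClosed_eq (continuous_apply x) continuous_const
    exact h1.inter (isClosed_eq (by fun_prop) continuous_const)
  have hcompact : IsCompact K := by
    refine (isCompact_univ_pi fun _ : V => isCompact_Icc (a := (-1 : ℝ)) (b := 1)).of_isClosed_subset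
      hclosed fun f hf x _ => ?_
    by_cases hx : x ∈ B
    · rw [hf.1 x hx]
      constructor <;> norm_num
    · have : f x ^ 2 ≤ 1 := by
        rw [← hf.2]
        exact Finset.single_le_sum (f := fun x => f x ^ 2) (fun _ _ => sq_nonneg _)
          (by simpa using hx)
      exact abs_le.1 ((sq_le_one_iff_abs_le_one _).1 this)
  have hne : K.Nonempty := by
    obtain ⟨x, hx⟩ := hB
    refine ⟨Pi.single x 1, fun y hy => ?_, ?_⟩
    · rw [Pi.single_eq_of_ne]
      rintro rfl
      exact (mem_compl.1 hx) hy
    · rw [Finset.sum_eq_single_of_mem x hx]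
      · simp
      · intro y _ hy
        simp [Pi.single_eq_of_ne hy]
  have hcont : Continuous fun f : V → ℝ => dirichletForm G f := by
    unfold dirichletForm
    refine Continuous.div_const (continuous_finsetSum _ fun x _ =>
      continuous_finsetSum _ fun y _ => ?_) _
    split_ifs <;> fun_prop
  obtain ⟨f, hfK, hmin⟩ := hcompact.exists_isMinOn hne hcont.continuousOn
  have hfn : f ≠ 0 := by
    rintro rfl
    simpa using hfK.2
  have hle : ∀ φ : V → ℝ, (∀ x ∈ B, φ x = 0) →
      dirichletForm G f * ∑ x ∈ Bᶜ, φ x ^ 2 ≤ dirichletForm G φ := by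
    intro φ hφ
    by_cases h0 : φ = 0
    · subst h0
      simpa using dirichletForm_nonneg 0
    · have hpos := sum_sq_pos hφ h0
      set s := ∑ x ∈ Bᶜ, φ x ^ 2
      have hmem : (√s)⁻¹ • φ ∈ K := by
        refine ⟨fun x hx => by simp [hφ x hx], ?_⟩
        simp only [Pi.smul_apply, smul_eq_mul, mul_pow, ← Finset.mul_sum, inv_pow]
        rw [Real.sq_sqrt hpos.le]
        exact inv_mul_cancel₀ hpos.ne'
      have := hmin hmem
      simp only [Set.mem_ofPred_eq, dirichletForm_smul, inv_pow, Real.sq_sqrt hpos.le] at this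
      rwa [← div_eq_inv_mul, le_div_iff₀ hpos] at this
  have heq : lambda1 G B = dirichletForm G f := by
    refine IsLeast.csInf_eq ⟨⟨f, hfK.1, hfn, ?_⟩, ?_⟩
    · rw [hfK.2, div_one]
    · rintro r ⟨φ, hφ, h0, rfl⟩
      rw [le_div_iff₀ (sum_sq_pos hφ h0)]
      exact hle φ hφ
  rw [heq]
  have habs : ∀ x ∈ B, |f x| = 0 := fun x hx => by simp [hfK.1 x hx]
  refine ⟨fun x => |f x|, habs, fun x => abs_nonneg _, ?_, ?_, hle⟩
  · intro h
    apply hfn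
    ext x
    simpa using congrFun h x
  · refine le_antisymm ?_ (hle _ habs)
    simp only [sq_abs]
    rw [hfK.2, mul_one]
    exact dirichletForm_abs_le f

lemma eq_zero_of_forall_nonneg {c d : ℝ} (h : ∀ t : ℝ, 0 ≤ 2 * t * c + t ^ 2 * d) : c = 0 := by
  by_contra hc
  have h1 := h (-(c / (|d| + 1)))
  have h2 : 0 < |d| + 1 := by positivity
  have h3 : 2 * -(c / (|d| + 1)) * c + (-(c / (|d| + 1))) ^ 2 * d =
      c ^ 2 / (|d| + 1) ^ 2 * (d - 2 * (|d| + 1)) := by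
    field_simp
    ring
  rw [h3] at h1
  have h4 : 0 < c ^ 2 / (|d| + 1) ^ 2 := by positivity
  have h5 : d - 2 * (|d| + 1) < 0 := by linarith [le_abs_self d, abs_nonneg d]
  nlinarith

/-- There is a nonnegative Dirichlet eigenfunction for the first Dirichlet eigenvalue. -/
lemma exists_eigenfunction (hB : Bᶜ.Nonempty) :
    ∃ f : V → ℝ, (∀ x ∈ B, f x = 0) ∧ (∀ x, 0 ≤ f x) ∧ f ≠ 0 ∧
      ∀ x ∉ B, graphLap G f x = lambda1 G B * f x := by
  obtain ⟨f, hf, hpos, hne, heq, hle⟩ := exists_minimizer (G := G) hB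
  refine ⟨f, hf, hpos, hne, fun v hv => ?_⟩
  rw [← sub_eq_zero]
  refine eq_zero_of_forall_nonneg (d := dirichletForm G (Pi.single v 1) - lambda1 G B) fun t => ?_
  have h1 := hle (f + t • (Pi.single v 1 : V → ℝ)) fun x hx => by
    have : x ≠ v := by
      rintro rfl
      exact hv hx
    simp [hf x hx, Pi.single_eq_of_ne this]
  have h2 : ∑ x, (Pi.single v 1 : V → ℝ) x * graphLap G f x = graphLap G f v := by
    simp [Pi.single_apply]
  have h3 : ∑ x ∈ Bᶜ, (f + t • (Pi.single v 1 : V → ℝ)) x ^ 2 =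
      ∑ x ∈ Bᶜ, f x ^ 2 + (2 * t * f v + t ^ 2) := by
    have h4 : ∀ x ∈ Bᶜ, (f + t • (Pi.single v 1 : V → ℝ)) x ^ 2 =
        f x ^ 2 + if x = v then 2 * t * f v + t ^ 2 else 0 := by
      intro x _
      simp only [Pi.add_apply, Pi.smul_apply, smul_eq_mul, Pi.single_apply]
      split_ifs with h
      · subst h; ring
      · ring
    rw [Finset.sum_congr rfl h4, Finset.sum_add_distrib, Finset.sum_ite_eq',
      if_pos (by simpa using hv)]
  rw [dirichletForm_add_smul, h2, h3, heq] at h1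
  linarith

/-- A positive Dirichlet eigenfunction belongs to the first Dirichlet eigenvalue. -/
lemma lambda1_eq_of_pos {Λ : ℝ} {h : V → ℝ} (hB : ∃ x, x ∉ B) (h0 : ∀ x ∈ B, h x = 0)
    (hpos : ∀ x ∉ B, 0 < h x) (hlap : ∀ x ∉ B, graphLap G h x = Λ * h x) :
    lambda1 G B = Λ := by
  have hne : h ≠ 0 := by
    rintro rfl
    obtain ⟨x, hx⟩ := hB
    exact lt_irrefl _ (hpos x hx)
  have hsum : ∀ φ ψ : V → ℝ, (∀ x ∈ B, φ x = 0) → (∀ x ∉ B, φ x * h x = ψ x ^ 2) →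
      ∑ x, φ x * graphLap G h x = Λ * ∑ x ∈ Bᶜ, ψ x ^ 2 := by
    intro φ ψ hφ hψ
    rw [Finset.mul_sum, ← Finset.sum_add_sum_compl B, Finset.sum_eq_zero, zero_add]
    · refine Finset.sum_congr rfl fun x hx => ?_
      rw [mem_compl] at hx
      rw [hlap x hx, ← hψ x hx]
      ring
    · intro x hx
      rw [hφ x hx, zero_mul]
  refine IsLeast.csInf_eq ⟨⟨h, h0, hne, ?_⟩, ?_⟩
  · rw [eq_div_iff (sum_sq_pos h0 hne).ne', dirichletForm_eq_sum, hsum h h h0 fun x _ => by ring]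
  · rintro r ⟨f, hf, hf0, rfl⟩
    rw [le_div_iff₀ (sum_sq_pos hf hf0),
      ← hsum (fun x => f x ^ 2 / h x) f (fun x hx => by simp [hf x hx])
        fun x hx => div_mul_cancel₀ _ (hpos x hx).ne', ← sum_mul_graphLap]
    refine div_le_div_of_nonneg_right
      (Finset.sum_le_sum fun x _ => Finset.sum_le_sum fun y _ => ?_) zero_le_two
    split_ifs
    · by_cases hx : x ∈ B
      · by_cases hy : y ∈ B
        · simp [hf x hx, hf y hy]
        · rw [hf x hx, h0 x hx]
          have : h y * (f y ^ 2 / h y) = f y ^ 2 := mul_div_cancel₀ _ (hpos y hy).ne'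
          linarith
      · have hx' := hpos x hx
        by_cases hy : y ∈ B
        · rw [hf y hy, h0 y hy]
          have : h x * (f x ^ 2 / h x) = f x ^ 2 := mul_div_cancel₀ _ hx'.ne'
          linarith
        · have hy' := hpos y hy
          have : (f x - f y) ^ 2 - (h x - h y) * (f x ^ 2 / h x - f y ^ 2 / h y) =
              h x * h y * (f x / h x - f y / h y) ^ 2 := by
            field_simp
            ring
          have h2 : 0 ≤ h x * h y * (f x / h x - f y / h y) ^ 2 := by positivity
          linarith
    · exact le_rfl

lemma dirichletForm_comp_iso {V' : Type*} [Fintype V'] {G' : SimpleGraph V'} (e : G ≃g G')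
    (f : V' → ℝ) : dirichletForm G (f ∘ e) = dirichletForm G' f := by
  unfold dirichletForm
  rw [← e.toEquiv.sum_comp fun x => ∑ y, if G'.Adj x y then (f x - f y) ^ 2 else 0]
  congr 1
  refine Finset.sum_congr rfl fun x _ => ?_
  rw [← e.toEquiv.sum_comp]
  refine Finset.sum_congr rfl fun y _ => ?_
  simp [e.map_adj_iff]

lemma mem_leaves_iso {V' : Type*} [Fintype V'] {G' : SimpleGraph V'} (e : G ≃g G') (x : V) :
    e x ∈ leaves G' ↔ x ∈ leaves G := by
  simp only [leaves, mem_filter, mem_univ, true_and]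
  rw [← e.degree_eq x]

lemma lambda1_leaves_iso {V' : Type*} [Fintype V'] {G' : SimpleGraph V'} (e : G ≃g G') :
    lambda1 G (leaves G) = lambda1 G' (leaves G') := by
  have hsum : ∀ f : V' → ℝ, ∑ x ∈ (leaves G)ᶜ, (f ∘ e) x ^ 2 = ∑ x ∈ (leaves G')ᶜ, f x ^ 2 := by
    intro f
    refine Finset.sum_equiv e.toEquiv (fun x => ?_) fun x _ => rfl
    simp only [mem_compl]
    exact not_congr (mem_leaves_iso e x).symm
  unfold lambda1
  congr 1
  ext r
  constructor
  · rintro ⟨f, hf, hne, rfl⟩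
    obtain ⟨f, rfl⟩ : ∃ f', f = f' ∘ e := ⟨f ∘ e.symm, by ext; simp⟩
    refine ⟨f, fun x hx => ?_, ?_, ?_⟩
    · have := hf (e.symm x) ((mem_leaves_iso e _).1 (by simpa using hx))
      simpa using this
    · rintro rfl
      exact hne rfl
    · rw [hsum, dirichletForm_comp_iso]
  · rintro ⟨f, hf, hne, rfl⟩
    refine ⟨f ∘ e, fun x hx => hf _ ((mem_leaves_iso e x).2 hx), ?_, ?_⟩
    · intro h
      apply hne
      ext x
      simpa using congrFun h (e.symm x)
    · rw [hsum, dirichletForm_comp_iso]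

end Dirichlet

section StarLikePath

/-- A star-like path tree's vertex set as an explicit disjoint union. -/
def slpVertEquiv (p q c d e : ℕ) :
    SLPVert p q c d e ≃ Fin (c + 1) ⊕ Fin d ⊕ Fin e ⊕ Fin p ⊕ Fin (if c = 0 then 0 else p) ⊕
      (Fin d × Fin q) ⊕ (Fin e × Fin q) ⊕ (Fin (c - 1) × Fin q) where
  toFun
    | .path i => .inl i
    | .dbr i => .inr (.inl i)
    | .ebr i => .inr (.inr (.inl i))
    | .pleaf0 i => .inr (.inr (.inr (.inl i)))
    | .pleafc i => .inr (.inr (.inr (.inr (.inl i))))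
    | .qleafD i j => .inr (.inr (.inr (.inr (.inr (.inl (i, j))))))
    | .qleafE i j => .inr (.inr (.inr (.inr (.inr (.inr (.inl (i, j)))))))
    | .qleafM i j => .inr (.inr (.inr (.inr (.inr (.inr (.inr (i, j)))))))
  invFun
    | .inl i => .path i
    | .inr (.inl i) => .dbr i
    | .inr (.inr (.inl i)) => .ebr i
    | .inr (.inr (.inr (.inl i))) => .pleaf0 i
    | .inr (.inr (.inr (.inr (.inl i)))) => .pleafc i
    | .inr (.inr (.inr (.inr (.inr (.inl (i, j)))))) => .qleafD i j
    | .inr (.inr (.inr (.inr (.inr (.inr (.inl (i, j))))))) => .qleafE i j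
    | .inr (.inr (.inr (.inr (.inr (.inr (.inr (i, j))))))) => .qleafM i j
  left_inv x := by cases x <;> rfl
  right_inv x := by rcases x with _ | _ | _ | _ | _ | ⟨_, _⟩ | ⟨_, _⟩ | ⟨_, _⟩ <;> rfl

lemma sum_slpVert {M : Type*} [AddCommMonoid M] {p q d e : ℕ} (F : SLPVert p q 2 d e → M) :
    ∑ x, F x = (F (.path 0) + F (.path 1) + F (.path 2)) + ((∑ i, F (.dbr i)) +
      ((∑ i, F (.ebr i)) + ((∑ i, F (.pleaf0 i)) + ((∑ i, F (.pleafc i)) +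
      ((∑ i, ∑ j, F (.qleafD i j)) + ((∑ i, ∑ j, F (.qleafE i j)) +
      ∑ j, F (.qleafM 0 j))))))) := by
  rw [← (slpVertEquiv p q 2 d e).symm.sum_comp]
  simp only [Fintype.sum_sum_type, Fintype.sum_prod_type]
  refine congrArg₂ (· + ·) (Fin.sum_univ_three fun i => F (.path i)) ?_
  iterate 6 refine congrArg₂ (· + ·) rfl ?_
  exact Fin.sum_univ_one fun i => ∑ j, F (.qleafM i j)

lemma card_slpVert (p q d e : ℕ) :
    Fintype.card (SLPVert p q 2 d e) = 3 + d + e + 2 * p + d * q + e * q + q := by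
  rw [Fintype.card_congr (slpVertEquiv p q 2 d e)]
  simp
  ring

variable {a d : ℕ}

/-- The function on a star-like path tree with value `α` at the middle path vertex, `1` at the two
other path vertices, `β` at the other interior vertices and `0` at the leaves. -/
def slpFun (α β : ℝ) : SLPVert (a + 1) a 2 d d → ℝ
  | .path i => if i = 1 then α else 1
  | .dbr _ => β
  | .ebr _ => β
  | _ => 0

lemma degree_eq_sum_ite {V : Type*} [Fintype V] (G : SimpleGraph V) (x : V) :
    G.degree x = ∑ y, if G.Adj x y then 1 else 0 := by
  rw [← SimpleGraph.card_neighborFinset_eq_degree, SimpleGraph.neighborFinset_eq_filter,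
    Finset.card_filter]

lemma slpFun_eq_zero_and_pos (ha : 1 ≤ a) {α β : ℝ} (hα : 0 < α) (hβ : 0 < β)
    (x : SLPVert (a + 1) a 2 d d) :
    (x ∈ leaves (SLP (a + 1) a 2 d d) → slpFun α β x = 0) ∧
      (x ∉ leaves (SLP (a + 1) a 2 d d) → 0 < slpFun α β x) := by
  simp only [leaves, mem_filter, mem_univ, true_and, degree_eq_sum_ite, sum_slpVert]
  rcases x with i | i | i | i | i | ⟨i, j⟩ | ⟨i, j⟩ | ⟨i, j⟩
  · fin_cases i
    all_goals simp [slpFun, SLP, SLPRel]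
    exact ⟨fun h => by omega, fun _ => hα⟩
  all_goals simp [slpFun, SLP, SLPRel]
  all_goals exact ⟨fun h => by omega, fun _ => hβ⟩

lemma graphLap_slpFun {μ : ℝ} (h0 : 0 < μ) (h1 : μ < 1)
    (hμ : 2 - (2 * d + 6) * μ + (d + 5) * μ ^ 2 - μ ^ 3 = 0) (x : SLPVert (a + 1) a 2 d d)
    (hx : slpFun (2 / (2 - μ)) (1 / (1 - μ)) x ≠ 0) :
    graphLap (SLP (a + 1) a 2 d d) (slpFun (2 / (2 - μ)) (1 / (1 - μ))) x =
      (a + μ) * slpFun (2 / (2 - μ)) (1 / (1 - μ)) x := by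
  have h2 : 1 - μ ≠ 0 := by linarith
  have h3 : 2 - μ ≠ 0 := by linarith
  rw [graphLap, sum_slpVert]
  rcases x with i | i | i | i | i | ⟨i, j⟩ | ⟨i, j⟩ | ⟨i, j⟩
  · fin_cases i
    all_goals simp [slpFun, SLP, SLPRel]
    · field_simp
      linear_combination hμ
    · field_simp
      ring
    · field_simp
      linear_combination hμ
  all_goals simp [slpFun, SLP, SLPRel] at hx ⊢
  all_goals
    field_simp
    ring

lemma exists_root (hd : 1 ≤ d) :
    ∃ μ : ℝ, 0 < μ ∧ μ < 1 ∧ 2 - (2 * d + 6) * μ + (d + 5) * μ ^ 2 - μ ^ 3 = 0 := by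
  have hcont : Continuous fun μ : ℝ => 2 - (2 * d + 6) * μ + (d + 5) * μ ^ 2 - μ ^ 3 := by
    fun_prop
  have hd' : (1 : ℝ) ≤ d := by exact_mod_cast hd
  obtain ⟨μ, hμ, h⟩ := intermediate_value_Ioo' zero_le_one hcont.continuousOn
    (show (0 : ℝ) ∈ _ by
      constructor
      · norm_num
        linarith
      · norm_num)
  exact ⟨μ, hμ.1, hμ.2, h⟩

/-- The first Dirichlet eigenvalue of the balanced star-like path tree of length two. -/
lemma exists_lambda1_slp (ha : 1 ≤ a) (hd : 1 ≤ d) :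
    ∃ μ : ℝ, 0 < μ ∧ μ < 1 ∧ 2 - (2 * d + 6) * μ + (d + 5) * μ ^ 2 - μ ^ 3 = 0 ∧
      lambda1 (SLP (a + 1) a 2 d d) (leaves (SLP (a + 1) a 2 d d)) = a + μ := by
  obtain ⟨μ, h0, h1, h⟩ := exists_root hd
  have hα : 0 < 2 / (2 - μ) := div_pos two_pos (by linarith)
  have hβ : 0 < 1 / (1 - μ) := div_pos one_pos (by linarith)
  have hleaf := slpFun_eq_zero_and_pos (d := d) ha hα hβ
  refine ⟨μ, h0, h1, h, lambda1_eq_of_pos (h := slpFun (2 / (2 - μ)) (1 / (1 - μ)))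
    ⟨.path 0, ?_⟩ (fun x => (hleaf x).1) (fun x => (hleaf x).2)
    fun x hx => graphLap_slpFun h0 h1 h x ((hleaf x).2 hx).ne'⟩
  intro hx
  have := (hleaf _).1 hx
  simp [slpFun] at this

lemma slp_connected : (SLP (a + 1) a 2 d d).Connected := by
  have hadj : ∀ x y, SLPRel x y → (SLP (a + 1) a 2 d d).Adj x y := by
    intro x y h
    rw [SLP, SimpleGraph.fromRel_adj]
    refine ⟨?_, Or.inl h⟩
    rintro rfl
    cases x <;> simp [SLPRel] at h
  have h1 : (SLP (a + 1) a 2 d d).Reachable (.path 0) (.path 1) :=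
    (hadj _ _ (by simp [SLPRel])).reachable
  have h2 : (SLP (a + 1) a 2 d d).Reachable (.path 0) (.path 2) :=
    h1.trans (hadj _ _ (by simp [SLPRel])).reachable
  have hD : ∀ i, (SLP (a + 1) a 2 d d).Reachable (.path 0) (.dbr i) := fun i =>
    (hadj _ _ (by simp [SLPRel])).reachable
  have hE : ∀ i, (SLP (a + 1) a 2 d d).Reachable (.path 0) (.ebr i) := fun i =>
    h2.trans (hadj _ _ (by simp [SLPRel])).reachable
  refine SimpleGraph.connected_iff_exists_forall_reachable _ |>.2 ⟨.path 0, fun x => ?_⟩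
  rcases x with i | i | i | i | i | ⟨i, j⟩ | ⟨i, j⟩ | ⟨i, j⟩
  · fin_cases i
    · rfl
    · exact h1
    · exact h2
  · exact hD i
  · exact hE i
  · exact (hadj _ _ (by simp [SLPRel])).reachable
  · exact h2.trans (hadj _ _ (by simp [SLPRel])).reachable
  · exact (hD i).trans (hadj _ _ (by simp [SLPRel])).reachable
  · exact (hE i).trans (hadj _ _ (by simp [SLPRel])).reachable
  · exact h1.trans (hadj _ _ (by simp [SLPRel])).reachable

end StarLikePath

section InteriorTree

variable {V : Type*} [Fintype V] {T : SimpleGraph V}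

/-- The vertices of degree different from one. -/
abbrev Interior (T : SimpleGraph V) : Type _ := {x : V // x ∉ leaves T}

/-- The graph induced on the interior vertices. -/
def interiorGraph (T : SimpleGraph V) : SimpleGraph (Interior T) := T.comap Subtype.val

/-- The number of leaves attached to a vertex. -/
noncomputable def leafCount (T : SimpleGraph V) (x : V) : ℕ := #{z ∈ leaves T | T.Adj x z}

lemma mem_leaves_iff {z : V} : z ∈ leaves T ↔ ∃! x, T.Adj z x := by
  simp only [leaves, mem_filter, mem_univ, true_and, SimpleGraph.degree_eq_one_iff_existsUnique_adj]

lemma not_mem_leaves_of_adj (hT : T.Connected) (hne : Nonempty (Interior T)) {x z : V}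
    (hz : z ∈ leaves T) (h : T.Adj z x) : x ∉ leaves T := by
  intro hx
  obtain ⟨y, hy⟩ := hne
  obtain rfl | rfl : y = z ∨ y = x := by
    refine hT.mem_of_adj_closed (X := {u | u = z ∨ u = x}) (x := z) ?_ (Or.inl rfl) y
    rintro u v huv (rfl | rfl)
    · exact Or.inr ((mem_leaves_iff.1 hz).unique huv h)
    · exact Or.inl ((mem_leaves_iff.1 hx).unique huv h.symm)
  · exact hy hz
  · exact hy hx

lemma interiorGraph_isTree (hT : T.IsTree) (hne : Nonempty (Interior T)) :
    (interiorGraph T).IsTree := by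
  refine ⟨SimpleGraph.connected_iff_exists_forall_reachable _ |>.2 ?_,
    hT.isAcyclic.comap ⟨Subtype.val, id⟩ Subtype.val_injective⟩
  obtain ⟨x⟩ := hne
  refine ⟨x, fun y => ?_⟩
  have key := hT.connected.mem_of_adj_closed
    (X := {u | ∃ v : Interior T, (interiorGraph T).Reachable x v ∧
      (v = u ∨ u ∈ leaves T ∧ T.Adj v u)})
    (x := x) ?_ ⟨x, .rfl, Or.inl rfl⟩ y
  · obtain ⟨v, hv, h | h⟩ := key
    · rwa [← Subtype.ext h]
    · exact absurd h.1 y.2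
  · rintro u u' huu ⟨v, hv, rfl | ⟨hu, h⟩⟩
    · by_cases hu' : u' ∈ leaves T
      · exact ⟨v, hv, Or.inr ⟨hu', huu⟩⟩
      · exact ⟨⟨u', hu'⟩, hv.trans (SimpleGraph.Adj.reachable (by exact huu)), Or.inl rfl⟩
    · exact ⟨v, hv, Or.inl ((mem_leaves_iff.1 hu).unique h.symm huu)⟩

lemma sum_leafCount (hT : T.Connected) (hne : Nonempty (Interior T)) :
    ∑ x : Interior T, leafCount T x = #(leaves T) := by
  simp only [leafCount, Finset.card_filter]
  rw [Finset.sum_comm, Finset.card_eq_sum_ones]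
  refine Finset.sum_congr rfl fun z hz => ?_
  obtain ⟨x, hx, hu⟩ := mem_leaves_iff.1 hz
  rw [Finset.sum_eq_single ⟨x, not_mem_leaves_of_adj hT hne hz hx⟩]
  · exact if_pos hx.symm
  · intro y _ hy
    exact if_neg fun h => hy (Subtype.ext (hu y h.symm))
  · simp

lemma graphLap_interior {f : V → ℝ} (hf : ∀ x ∈ leaves T, f x = 0) (x : V) :
    graphLap T f x = leafCount T x * f x + ∑ y : Interior T, if T.Adj x y then f x - f y else 0 := by
  rw [graphLap, ← Fintype.sum_subtype_add_sum_subtype (· ∈ leaves T)]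
  congr 1
  rw [leafCount, Finset.card_filter, Nat.cast_sum, Finset.sum_mul,
    Finset.sum_subtype (leaves T) fun _ => Iff.rfl]
  refine Finset.sum_congr rfl fun z _ => ?_
  rw [hf z z.2]
  split_ifs <;> simp

/-- The ratios of the first Dirichlet eigenfunction along the edges of the interior tree. -/
lemma exists_isEigenRatio (hT : T.IsTree) (hne : Nonempty (Interior T)) (a : ℕ) :
    ∃ w, IsEigenRatio (interiorGraph T) (fun x => (leafCount T x : ℤ) - a)
      (lambda1 T (leaves T) - a) w := by
  have hH := interiorGraph_isTree hT hne
  obtain ⟨f, hf, hnn, hf0, hlap⟩ := exists_eigenfunction (G := T) (B := leaves T)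
    (by obtain ⟨x, hx⟩ := hne; exact ⟨x, mem_compl.2 hx⟩)
  have hpos : ∀ x : Interior T, 0 < f x := by
    intro x
    refine lt_of_le_of_ne (hnn x) fun hx => hf0 ?_
    ext y
    by_cases hy : y ∈ leaves T
    · exact hf y hy
    refine hH.connected.mem_of_adj_closed (X := {u | f u = 0}) ?_ hx.symm ⟨y, hy⟩
    intro u v huv hu
    have h := hlap u u.2
    rw [graphLap_interior hf, show f u = 0 from hu, mul_zero, mul_zero, zero_add] at h
    have h2 := (Finset.sum_eq_zero_iff_of_nonpos fun y _ => ?_).1 h v (mem_univ v)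
    · rw [if_pos (show T.Adj u v from huv)] at h2
      exact neg_eq_zero.1 ((zero_sub (f v)).symm.trans h2)
    · split_ifs
      · linarith [hnn y]
      · exact le_rfl
  refine ⟨fun x y => 1 - f y / f x, fun x y _ => ?_, fun x y _ => ?_, fun x => ?_⟩
  · linarith [div_pos (hpos y) (hpos x)]
  · have := (hpos x).ne'
    have := (hpos y).ne'
    rw [sub_sub_cancel, sub_sub_cancel]
    field_simp
  · have h := hlap x x.2
    have hx := hpos x
    rw [graphLap_interior hf] at h
    have h2 : ∑ y : Interior T, (if T.Adj x y then f x - f y else 0) =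
        f x * ∑ y : Interior T, if T.Adj x y then 1 - f y / f x else 0 := by
      rw [Finset.mul_sum]
      refine Finset.sum_congr rfl fun y _ => ?_
      rw [mul_ite, mul_zero, mul_sub, mul_one, mul_div_cancel₀ _ hx.ne']
    rw [h2] at h
    refine mul_left_cancel₀ hx.ne' ?_
    change f x * (∑ y : Interior T, if T.Adj x y then 1 - f y / f x else 0) = _
    push_cast
    linear_combination h

lemma exists_leaf_enum {x : V} {n : ℕ} (h : leafCount T x = n) :
    ∃ F : Fin n → V, (∀ i, T.Adj x (F i)) ∧ ∀ z ∈ leaves T, T.Adj x z → ∃ i, F i = z := by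
  refine ⟨fun i => (Finset.equivFinOfCardEq h).symm i, fun i => ?_, fun z hz hxz => ?_⟩
  · exact (mem_filter.1 ((Finset.equivFinOfCardEq h).symm i).2).2
  · exact ⟨Finset.equivFinOfCardEq h ⟨z, mem_filter.2 ⟨hz, hxz⟩⟩, by simp⟩

end InteriorTree

section Characterization

variable {V : Type*} [Fintype V] {T : SimpleGraph V}

lemma exists_neighbor_enum {y v : Interior T} {d : ℕ}
    (h : #{z | (interiorGraph T).Adj y z ∧ z ≠ v} = d) :
    ∃ F : Fin d → Interior T, (∀ i, T.Adj y (F i) ∧ F i ≠ v) ∧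
      ∀ z : Interior T, T.Adj y z → z ≠ v → ∃ i, F i = z := by
  refine ⟨fun i => (Finset.equivFinOfCardEq h).symm i, fun i => ?_, fun z hz hv => ?_⟩
  · exact (mem_filter.1 ((Finset.equivFinOfCardEq h).symm i).2).2
  · exact ⟨Finset.equivFinOfCardEq h ⟨z, mem_filter.2 ⟨mem_univ z, hz, hv⟩⟩, by simp⟩

/-- A tree is isomorphic to a connected graph that maps onto it and has as many vertices. -/
lemma nonempty_iso_of_surjective {V' : Type*} [Fintype V'] {G : SimpleGraph V'} (hT : T.IsTree)
    (hG : G.Connected) (φ : G →g T) (hφ : Function.Surjective φ)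
    (hcard : Fintype.card V = Fintype.card V') : Nonempty (T ≃g G) := by
  let e : V' ≃ V := Equiv.ofBijective φ
    ((Fintype.bijective_iff_surjective_and_card φ).2 ⟨hφ, hcard.symm⟩)
  have hle : G.comap e.symm ≤ T := by
    intro x y h
    have := φ.map_adj h
    change T.Adj (e (e.symm x)) (e (e.symm y)) at this
    simpa using this
  have hconn : (G.comap e.symm).Connected :=
    (SimpleGraph.Iso.comap e.symm G).connected_iff.2 hG
  have heq : T = G.comap e.symm :=
    le_antisymm ((SimpleGraph.isTree_iff_minimal_connected.1 hT).2 hconn hle) hle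
  rw [heq]
  exact ⟨SimpleGraph.Iso.comap e.symm G⟩

lemma nonempty_iso_slp {a d : ℕ} (hT : T.IsTree) {v y₁ y₂ : Interior T}
    (h₁ : T.Adj v y₁) (h₂ : T.Adj v y₂) (c₀ : leafCount T v = a)
    (c₁ : leafCount T y₁ = a + 1) (c₂ : leafCount T y₂ = a + 1)
    (hz : ∀ z : Interior T, z ≠ v → z ≠ y₁ → z ≠ y₂ →
      leafCount T z = a ∧ (T.Adj y₁ z ∨ T.Adj y₂ z))
    (d₁ : #{z | (interiorGraph T).Adj y₁ z ∧ z ≠ v} = d)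
    (d₂ : #{z | (interiorGraph T).Adj y₂ z ∧ z ≠ v} = d)
    (hcard : Fintype.card V = Fintype.card (SLPVert (a + 1) a 2 d d)) :
    Nonempty (T ≃g SLP (a + 1) a 2 d d) := by
  have htri : ¬ T.Adj y₁ y₂ := fun h => hT.isAcyclic.cliqueFree le_rfl {v.1, y₁.1, y₂.1}
    (SimpleGraph.is3Clique_triple_iff.2 ⟨h₁, h₂, h⟩)
  obtain ⟨D, hD, hD'⟩ := exists_neighbor_enum d₁
  obtain ⟨E, hE, hE'⟩ := exists_neighbor_enum d₂
  have cD : ∀ i, leafCount T (D i) = a := fun i => by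
    refine (hz _ (hD i).2 ?_ ?_).1
    · rintro h
      exact T.irrefl (h ▸ (hD i).1)
    · rintro h
      exact htri (h ▸ (hD i).1)
  have cE : ∀ i, leafCount T (E i) = a := fun i => by
    refine (hz _ (hE i).2 ?_ ?_).1
    · rintro h
      exact htri (h ▸ (hE i).1).symm
    · rintro h
      exact T.irrefl (h ▸ (hE i).1)
  obtain ⟨L₀, hL₀, hL₀'⟩ := exists_leaf_enum c₀
  obtain ⟨L₁, hL₁, hL₁'⟩ := exists_leaf_enum c₁
  obtain ⟨L₂, hL₂, hL₂'⟩ := exists_leaf_enum c₂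
  choose LD hLD hLD' using fun i => exists_leaf_enum (cD i)
  choose LE hLE hLE' using fun i => exists_leaf_enum (cE i)
  let φ : SLPVert (a + 1) a 2 d d → V
    | .path i => if i = 0 then y₁ else if i = 1 then v else y₂
    | .dbr i => D i
    | .ebr i => E i
    | .pleaf0 i => L₁ i
    | .pleafc i => L₂ i
    | .qleafD i j => LD i j
    | .qleafE i j => LE i j
    | .qleafM _ j => L₀ j
  have hrel : ∀ x y, SLPRel x y → T.Adj (φ x) (φ y) := by
    rintro (i | i | i | i | i | ⟨i, j⟩ | ⟨i, j⟩ | ⟨i, j⟩)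
      (i' | i' | i' | i' | i' | ⟨i', j'⟩ | ⟨i', j'⟩ | ⟨i', j'⟩) h
    all_goals try exact h.elim
    · fin_cases i <;> fin_cases i' <;> simp [SLPRel, φ] at h ⊢
      · exact h₁.symm
      · exact h₂
    · obtain rfl : i = 0 := Fin.ext h
      exact (hD i').1
    · obtain rfl : i = 2 := Fin.ext h
      exact (hE i').1
    · obtain rfl : i = 0 := Fin.ext h
      exact hL₁ i'
    · obtain rfl : i = 2 := Fin.ext h
      exact hL₂ i'
    · obtain rfl : i = 1 := Fin.ext (h.trans (congrArg (· + 1) (Nat.lt_one_iff.1 i'.2)))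
      exact hL₀ j'
    · obtain rfl : i = i' := h
      exact hLD i j'
    · obtain rfl : i = i' := h
      exact hLE i j'
  have hφ : Function.Surjective φ := by
    have hint : ∀ z : Interior T, z = v ∨ z = y₁ ∨ z = y₂ ∨ (∃ i, D i = z) ∨ ∃ i, E i = z := by
      intro z
      by_cases e₀ : z = v
      · exact Or.inl e₀
      by_cases e₁ : z = y₁
      · exact Or.inr (Or.inl e₁)
      by_cases e₂ : z = y₂
      · exact Or.inr (Or.inr (Or.inl e₂))
      rcases (hz z e₀ e₁ e₂).2 with h | h
      · exact Or.inr (Or.inr (Or.inr (Or.inl (hD' z h e₀))))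
      · exact Or.inr (Or.inr (Or.inr (Or.inr (hE' z h e₀))))
    intro z
    by_cases hz : z ∈ leaves T
    · obtain ⟨x, hx, -⟩ := mem_leaves_iff.1 hz
      have hx' := not_mem_leaves_of_adj hT.connected ⟨v⟩ hz hx
      rcases hint ⟨x, hx'⟩ with h | h | h | ⟨i, h⟩ | ⟨i, h⟩
      all_goals
        replace h := congrArg Subtype.val h
        subst h
      · obtain ⟨j, rfl⟩ := hL₀' z hz hx.symm
        exact ⟨.qleafM 0 j, rfl⟩
      · obtain ⟨j, rfl⟩ := hL₁' z hz hx.symm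
        exact ⟨.pleaf0 j, rfl⟩
      · obtain ⟨j, rfl⟩ := hL₂' z hz hx.symm
        exact ⟨.pleafc j, rfl⟩
      · obtain ⟨j, rfl⟩ := hLD' i z hz hx.symm
        exact ⟨.qleafD i j, rfl⟩
      · obtain ⟨j, rfl⟩ := hLE' i z hz hx.symm
        exact ⟨.qleafE i j, rfl⟩
    · rcases hint ⟨z, hz⟩ with h | h | h | ⟨i, h⟩ | ⟨i, h⟩
      all_goals
        replace h := congrArg Subtype.val h
        subst h
      · exact ⟨.path 1, rfl⟩
      · exact ⟨.path 0, rfl⟩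
      · exact ⟨.path 2, rfl⟩
      · exact ⟨.dbr i, rfl⟩
      · exact ⟨.ebr i, rfl⟩
  refine nonempty_iso_of_surjective hT slp_connected ⟨φ, fun {x y} h => ?_⟩ hφ hcard
  rcases h.2 with h | h
  · exact hrel x y h
  · exact (hrel y x h).symm

end Characterization

section Comparison

variable {V : Type*} [Fintype V] {T : SimpleGraph V}

/-- Trees whose first Dirichlet eigenvalue is at least that of the balanced star-like path tree. -/
lemma nonempty_iso_slp_of_le {a d : ℕ} {μ : ℝ} (hT : T.IsTree) (hd : 1 ≤ d)
    (hint : Fintype.card (Interior T) = 2 * d + 3)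
    (hleaf : #(leaves T) = a * (2 * d + 3) + 2) (h0 : 0 < μ)
    (hμ : 2 - (2 * d + 6) * μ + (d + 5) * μ ^ 2 - μ ^ 3 = 0)
    (hle : a + μ ≤ lambda1 T (leaves T)) : Nonempty (T ≃g SLP (a + 1) a 2 d d) := by
  have hne : Nonempty (Interior T) := Fintype.card_pos_iff.1 (by omega)
  obtain ⟨w, hw⟩ := exists_isEigenRatio hT hne a
  set lam := lambda1 T (leaves T) - a with hlam
  have hml : μ ≤ lam := by linarith
  have hg : ∑ x : Interior T, ((leafCount T x : ℤ) - a) = 2 := by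
    rw [Finset.sum_sub_distrib, ← Nat.cast_sum, sum_leafCount hT.connected hne, hleaf,
      Finset.sum_const, Finset.card_univ, hint]
    push_cast
    ring
  have hk : 5 ≤ Fintype.card (Interior T) := by omega
  have hl := hw.lam_lt_half hg hk
  have hd' : (1 : ℝ) ≤ d := by exact_mod_cast hd
  obtain ⟨v, y₁, y₂, h₁, h₂, -, g₀, g₁, g₂, hz, d₁, d₂⟩ :=
    hw.exists_double_star (interiorGraph_isTree hT hne) (h0.trans_le hml) hg hk (by
      rw [hint]
      push_cast
      have e : 2 - (2 * d + 3) * μ = (2 * d) * (μ ^ 2 / (1 - μ)) + μ ^ 2 / (2 - μ) := by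
        have : 1 - μ ≠ 0 := by linarith
        have : 2 - μ ≠ 0 := by linarith
        field_simp
        linear_combination 2 * hμ
      have m₁ : μ ^ 2 / (1 - μ) ≤ lam ^ 2 / (1 - lam) :=
        div_le_div₀ (sq_nonneg _) (by gcongr) (by linarith) (by linarith)
      have m₂ : μ ^ 2 / (2 - μ) ≤ lam ^ 2 / (2 - lam) :=
        div_le_div₀ (sq_nonneg _) (by gcongr) (by linarith) (by linarith)
      nlinarith)
  have hcard : ∀ n, 2 * n + 3 = Fintype.card (Interior T) → n = d := fun n hn => by omega
  refine nonempty_iso_slp hT h₁ h₂ (by omega) (by omega) (by omega) (fun z e₀ e₁ e₂ => ?_)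
    (by convert hcard _ d₁) (by convert hcard _ d₂) ?_
  · obtain ⟨hz₁, hz₂⟩ := hz z e₀ e₁ e₂
    exact ⟨by omega, hz₂⟩
  · have e₁ := Finset.card_add_card_compl (leaves T)
    have e₂ : Fintype.card (Interior T) = #(leaves T)ᶜ :=
      Fintype.card_of_subtype _ fun x => mem_compl
    rw [card_slpVert, ← e₁, ← e₂, hint, hleaf]
    ring

end Comparison

theorem stmt19 {V : Type*} [Fintype V] (a k : ℕ) (ha : 1 ≤ a) (hk : 5 ≤ k) (hko : Odd k)
    (T : SimpleGraph V) (hT : T.IsTree)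
    (hint : ((leaves T)ᶜ : Finset V).card = k)
    (hleaf : (leaves T).card = a * k + 2) :
    lambda1 T (leaves T) ≤
      lambda1 (SLP (a + 1) a 2 ((k - 3) / 2) ((k - 3) / 2))
        (leaves (SLP (a + 1) a 2 ((k - 3) / 2) ((k - 3) / 2))) ∧
    (lambda1 T (leaves T) =
        lambda1 (SLP (a + 1) a 2 ((k - 3) / 2) ((k - 3) / 2))
          (leaves (SLP (a + 1) a 2 ((k - 3) / 2) ((k - 3) / 2))) ↔
      Nonempty (T ≃g SLP (a + 1) a 2 ((k - 3) / 2) ((k - 3) / 2))) := by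
  obtain ⟨d, rfl⟩ : ∃ d, k = 2 * d + 3 := by
    obtain ⟨m, rfl⟩ := hko
    exact ⟨m - 1, by omega⟩
  rw [show (2 * d + 3 - 3) / 2 = d by omega]
  have hd : 1 ≤ d := by omega
  obtain ⟨μ, h0, h1, hμ, hslp⟩ := exists_lambda1_slp (a := a) (d := d) ha hd
  have hint' : Fintype.card (Interior T) = 2 * d + 3 :=
    (Fintype.card_of_subtype _ fun x => mem_compl).trans hint
  have hiso : a + μ ≤ lambda1 T (leaves T) → Nonempty (T ≃g SLP (a + 1) a 2 d d) :=
    nonempty_iso_slp_of_le hT hd hint' hleaf h0 hμ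
  have heq : Nonempty (T ≃g SLP (a + 1) a 2 d d) →
      lambda1 T (leaves T) = lambda1 (SLP (a + 1) a 2 d d) (leaves (SLP (a + 1) a 2 d d)) :=
    fun ⟨e⟩ => lambda1_leaves_iso e
  refine ⟨?_, fun h => hiso (hslp ▸ h.ge), heq⟩
  by_contra hlt
  exact hlt (heq (hiso (hslp ▸ (not_le.1 hlt).le))).le
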